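/- Let ε > 0. There exists a constant C_ε > 1 such that for all pairwise coprime positive integers a, b, c with a + b = c, writing ν = ω(abc) for the number of distinct prime divisors of abc, one has d(abc) / (log d(abc))^ν < C_ε^ν · ν^{2ν²} · rad(abc)^{1 + εν}. -/

import Mathlib

section
open Polynomial in
theorem trace_radical_zero {K : Type*} [Field K] [Algebra ℚ K] [FiniteDimensional ℚ K]
    {l : ℕ} (hl : l.Prime) (r : K) (a : ℚ) (hr : r ^ l = algebraMap ℚ K a)
    (ha : ∀ b : ℚ, b ^ l ≠ a) : Algebra.trace ℚ K r = 0 := by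
  have hirr := X_pow_sub_C_irreducible_of_prime hl ha
  have hmon : (X ^ l - C a : ℚ[X]).Monic := monic_X_pow_sub_C a hl.ne_zero
  have hmin : X ^ l - C a = minpoly ℚ r := by
    apply minpoly.eq_of_irreducible_of_monic hirr _ hmon
    simp [hr]
  rw [trace_eq_finrank_mul_minpoly_nextCoeff, ← hmin]
  have : (X ^ l - C a : ℚ[X]).nextCoeff = 0 := by
    have h2 := hl.two_le
    rw [nextCoeff_of_natDegree_pos (by rw [natDegree_X_pow_sub_C]; omega), natDegree_X_pow_sub_C]
    simp only [coeff_sub, coeff_X_pow, coeff_C]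
    rw [if_neg (by omega), if_neg (by omega)]; simp
  rw [this]; simp

theorem padicValRat_prod_primes {n : ℕ} (q : Fin n → ℕ) (hq : ∀ i, (q i).Prime)
    (hinj : Function.Injective q) (z : Fin n → ℤ) (i : Fin n) :
    padicValRat (q i) (∏ j, (q j : ℚ) ^ z j) = z i := by
  have := Fact.mk (hq i)
  have key : ∀ s : Finset (Fin n), padicValRat (q i) (∏ j ∈ s, (q j : ℚ) ^ z j)
      = ∑ j ∈ s, if j = i then z j else 0 := by
    intro s
    induction s using Finset.induction_on with
    | empty => simp
    | insert a s ha ih =>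
      have hne : ∀ j, (q j : ℚ) ^ z j ≠ 0 := fun j => zpow_ne_zero _ (by exact_mod_cast (hq j).ne_zero)
      rw [Finset.prod_insert ha, Finset.sum_insert ha, padicValRat.mul (hne a)
        (Finset.prod_ne_zero_iff.2 fun j _ => hne j), ih, padicValRat.zpow]
      congr 1
      by_cases h : a = i
      · subst h; simp [padicValRat.of_nat, padicValNat_self]
      · have : padicValNat (q i) (q a) = 0 := by
          apply padicValNat.eq_zero_of_not_dvd
          intro hd
          exact h (hinj ((Nat.prime_dvd_prime_iff_eq (hq i) (hq a)).1 hd)).symm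
        simp [padicValRat.of_nat, this, h]
  rw [key]; simp

theorem radicals_indep_field {K : Type*} [Field K] [Algebra ℚ K] [FiniteDimensional ℚ K]
    {n l : ℕ} (hl : l.Prime) (q : Fin n → ℕ) (hq : ∀ i, (q i).Prime)
    (hinj : Function.Injective q) (ρ : Fin n → K) (hρ : ∀ i, ρ i ^ l = (q i : K))
    (f : (Fin n → Fin l) → ℚ)
    (h : ∑ e, algebraMap ℚ K (f e) * ∏ i, ρ i ^ (e i : ℕ) = 0) : f = 0 := by
  have hρ0 : ∀ i, ρ i ≠ 0 := by
    intro i hi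
    have hh := hρ i
    rw [hi, zero_pow hl.ne_zero] at hh
    have : CharZero K := algebraRat.charZero K
    exact (hq i).ne_zero (by exact_mod_cast hh.symm)
  funext e0
  have h1 : ∑ e, algebraMap ℚ K (f e) * ∏ i, ρ i ^ ((e i : ℤ) - (e0 i : ℤ)) = 0 := by
    have : ∀ e : Fin n → Fin l, ∏ i, ρ i ^ ((e i : ℤ) - (e0 i : ℤ))
        = (∏ i, ρ i ^ (e i : ℕ)) * (∏ i, ρ i ^ (e0 i : ℕ))⁻¹ := by
      intro e
      rw [← Finset.prod_inv_distrib, ← Finset.prod_mul_distrib]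
      apply Finset.prod_congr rfl; intro i _
      rw [zpow_sub₀ (hρ0 i), zpow_natCast, zpow_natCast, div_eq_mul_inv]
    simp_rw [this, ← mul_assoc]
    rw [← Finset.sum_mul, h, zero_mul]
  have h2 := congrArg (Algebra.trace ℚ K) h1
  rw [map_sum, map_zero] at h2
  rw [Finset.sum_eq_single e0] at h2
  · simp only [sub_self, zpow_zero, Finset.prod_const_one, mul_one] at h2
    rw [Algebra.trace_algebraMap] at h2
    have hf : Module.finrank ℚ K ≠ 0 := Module.finrank_pos.ne'
    simpa [hf] using h2
  · intro e _ hne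
    rw [← Algebra.smul_def, map_smul]
    have hz : ∃ i, e i ≠ e0 i := by
      by_contra hcon
      push Not at hcon
      exact hne (funext hcon)
    obtain ⟨i, hi⟩ := hz
    rw [trace_radical_zero hl _ (∏ j, (q j : ℚ) ^ ((e j : ℤ) - (e0 j : ℤ)))]
    · simp
    · rw [← Finset.prod_pow, map_prod]
      apply Finset.prod_congr rfl; intro j _
      rw [map_zpow₀, map_natCast, ← hρ j, ← zpow_natCast, ← zpow_mul, ← zpow_natCast, ← zpow_mul, mul_comm]
    · intro b hb
      have := Fact.mk (hq i)
      have hv := congrArg (padicValRat (q i)) hb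
      rw [padicValRat_prod_primes q hq hinj] at hv
      rw [padicValRat.pow] at hv
      have hd : (l : ℤ) ∣ (e i : ℤ) - (e0 i : ℤ) := ⟨_, hv.symm⟩
      have : (e i : ℤ) - (e0 i : ℤ) = 0 := by
        apply Int.eq_zero_of_abs_lt_dvd hd
        rw [abs_lt]; have := (e i).2; have := (e0 i).2; constructor <;> omega
      exact hi (Fin.ext (by omega))
  · simp

theorem radicals_indep {n l : ℕ} (hl : l.Prime) (q : Fin n → ℕ) (hq : ∀ i, (q i).Prime)
    (hinj : Function.Injective q) (ρ : Fin n → ℝ) (hρ : ∀ i, ρ i ^ l = (q i : ℝ))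
    (f : (Fin n → Fin l) → ℚ)
    (h : ∑ e, (f e : ℝ) * ∏ i, ρ i ^ (e i : ℕ) = 0) : f = 0 := by
  let K := IntermediateField.adjoin ℚ (Set.range ρ)
  have : FiniteDimensional ℚ K := by
    apply IntermediateField.finiteDimensional_adjoin
    rintro x ⟨i, rfl⟩
    refine ⟨Polynomial.X ^ l - Polynomial.C (q i : ℚ), Polynomial.monic_X_pow_sub_C _ hl.ne_zero, ?_⟩
    simp [hρ i]
  let ρ' : Fin n → K := fun i => ⟨ρ i, IntermediateField.subset_adjoin _ _ ⟨i, rfl⟩⟩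
  apply radicals_indep_field (K := K) hl q hq hinj ρ'
  · intro i; apply Subtype.ext; simp [ρ', hρ i]
  · apply Subtype.ext
    simpa [ρ'] using h

end

section
def bbox (n L : ℕ) : Finset (Fin n → ℕ) := Fintype.piFinset (fun _ => Finset.range L)

def qpow {n : ℕ} (q : Fin n → ℕ) (e : Fin n → ℕ) : ℕ := ∏ i, q i ^ e i

theorem mem_bbox {n L : ℕ} {v : Fin n → ℕ} : v ∈ bbox n L ↔ ∀ i, v i < L := by
  simp [bbox]

theorem card_bbox {n L : ℕ} : (bbox n L).card = L ^ n := by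
  simp [bbox]

def fracMat {n : ℕ} (l : ℕ) (q : Fin n → ℕ) (s : ℕ) (B : Finset (Fin n → ℕ)) (C : (Fin n → ℕ) → ℤ) :
    Matrix (Fin n → Fin l) (Fin n → Fin l) ℤ := fun e e' =>
  ∑ v ∈ B, if (∀ i, (v i * s + e i) % l = e' i) then
    C v * ∏ i, (q i : ℤ) ^ ((v i * s + e i) / l) else 0

theorem fracMat_mul {n l : ℕ} (hl : 0 < l) (q : Fin n → ℕ) (s : ℕ) (B : Finset (Fin n → ℕ))
    (C : (Fin n → ℕ) → ℤ) {R : Type*} [CommRing R] (r : Fin n → R) (hr : ∀ i, r i ^ l = (q i : R))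
    (e : Fin n → Fin l) :
    ∑ e', (fracMat l q s B C e e' : R) * ∏ i, r i ^ (e' i : ℕ)
      = (∑ v ∈ B, (C v : R) * ∏ i, r i ^ (v i * s)) * ∏ i, r i ^ (e i : ℕ) := by
  simp only [fracMat, Int.cast_sum]
  simp_rw [Finset.sum_mul]
  rw [Finset.sum_comm]
  apply Finset.sum_congr rfl
  intro v _
  rw [Finset.sum_eq_single (fun i => ⟨(v i * s + e i) % l, Nat.mod_lt _ hl⟩)]
  · simp only [implies_true, if_true]
    push_cast
    rw [mul_assoc, mul_assoc, ← Finset.prod_mul_distrib, ← Finset.prod_mul_distrib]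
    congr 1
    apply Finset.prod_congr rfl
    intro i _
    rw [← hr i, ← pow_mul, ← pow_add, ← pow_add, Nat.div_add_mod]
  · intro e' _ hne
    rw [if_neg]; · simp
    intro h
    apply hne
    funext i
    exact Fin.ext (h i).symm
  · simp

theorem fracMat_abs_le {n l : ℕ} (q : Fin n → ℕ) (s : ℕ) (B : Finset (Fin n → ℕ))
    (C : (Fin n → ℕ) → ℤ) (e e' : Fin n → Fin l) (M : ℤ)
    (hM : ∑ v ∈ B, |C v| * ∏ i, (q i : ℤ) ^ ((v i * s + e i) / l) ≤ M) :
    |fracMat l q s B C e e'| ≤ M := by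
  refine le_trans (le_trans (Finset.abs_sum_le_sum_abs _ _) (Finset.sum_le_sum fun v _ => ?_)) hM
  split_ifs
  · rw [abs_mul, Finset.abs_prod]; simp
  · simp; positivity

theorem frac_step {n p l U s L : ℕ} (hp : p.Prime) (hl : l.Prime) (hlp : ¬ l ∣ p * (p - 1))
    (q : Fin n → ℕ) (hq : ∀ i, (q i).Prime) (hqp : ∀ i, q i ≠ p) (hinj : Function.Injective q)
    (C : (Fin n → ℕ) → ℤ) (hs : ¬ l ∣ s)
    (hdiv : ∀ t : ℕ, (p : ℤ) ^ U ∣ ∑ v ∈ bbox n (l * L), C v * (qpow q v : ℤ) ^ t)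
    (M : ℤ) (hM : ∀ e : Fin n → Fin l,
      ∑ v ∈ bbox n (l * L), |C v| * ∏ i, (q i : ℤ) ^ ((v i * s + e i) / l) ≤ M)
    (hbig : ((l : ℤ) ^ n * M) ^ (l ^ n) < (p : ℤ) ^ U) (e0 : Fin n → Fin l) :
    ∑ m ∈ bbox n L, C (fun i => e0 i + l * m i) * (qpow q m : ℤ) ^ s = 0 := by
  set Mt := fracMat l q s (bbox n (l * L)) C with hMt
  have hlpos := hl.pos
  have : NeZero l := ⟨hl.ne_zero⟩
  have hM0 : 0 ≤ M := le_trans (Finset.sum_nonneg fun v _ => by positivity) (hM (fun _ => 0))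
  -- step 1 : p^U divides det
  have hdet : (p : ℤ) ^ U ∣ Mt.det := by
    have hcop : Nat.Coprime l (Nat.totient (p ^ U)) := by
      rcases Nat.eq_zero_or_pos U with h0 | h0
      · subst h0; simp
      · rw [Nat.totient_prime_pow hp h0]
        rw [Nat.Prime.coprime_iff_not_dvd hl]
        intro h
        rcases hl.dvd_mul.1 h with h | h
        · exact hlp (Dvd.dvd.mul_right (hl.dvd_of_dvd_pow h) _)
        · exact hlp (Dvd.dvd.mul_left h _)
    obtain ⟨l', hl'⟩ : ∃ l', l * l' ≡ 1 [MOD Nat.totient (p ^ U)] :=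
      by
        obtain ⟨m, _, hm⟩ := Nat.exists_mul_mod_eq_of_coprime 1 hcop
          (Nat.totient_pos.2 (pow_pos hp.pos _)).ne'
        exact ⟨m, hm⟩
    have hr : ∀ i, ((q i : ZMod (p ^ U)) ^ l') ^ l = (q i : ZMod (p ^ U)) := by
      intro i
      have hc : Nat.Coprime (q i) (p ^ U) :=
        Nat.Coprime.pow_right _ ((Nat.coprime_primes (hq i) hp).2 (hqp i))
      rw [← pow_mul, mul_comm l' l]
      have hu : ((ZMod.unitOfCoprime (q i) hc) ^ (Nat.totient (p ^ U))) = 1 := ZMod.pow_totient _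
      have h2 : (ZMod.unitOfCoprime (q i) hc) ^ (l * l') = (ZMod.unitOfCoprime (q i) hc) ^ 1 := by
        rw [pow_eq_pow_iff_modEq]
        exact hl'.of_dvd (orderOf_dvd_of_pow_eq_one hu)
      have h3 := congrArg Units.val h2
      simpa using h3
    have hmul := fracMat_mul hlpos q s (bbox n (l * L)) C (fun i => (q i : ZMod (p ^ U)) ^ l') hr
    have hX : (∑ v ∈ bbox n (l * L), (C v : ZMod (p ^ U)) *
        ∏ i, ((q i : ZMod (p ^ U)) ^ l') ^ (v i * s)) = 0 := by
      have h := hdiv (l' * s)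
      have h' := (ZMod.intCast_zmod_eq_zero_iff_dvd (∑ v ∈ bbox n (l * L), C v * (qpow q v : ℤ) ^ (l' * s)) (p ^ U)).2
        (by exact_mod_cast h)
      rw [← h']
      push_cast
      apply Finset.sum_congr rfl
      intro v _
      congr 1
      rw [qpow]; push_cast
      rw [← Finset.prod_pow]
      apply Finset.prod_congr rfl; intro i _
      rw [← pow_mul, ← pow_mul]; congr 1; ring
    rw [hX] at hmul
    set MZ := Mt.map (Int.castRingHom (ZMod (p ^ U))) with hMZ
    have hvec : MZ.mulVec (fun e' => ∏ i, ((q i : ZMod (p ^ U)) ^ l') ^ (e' i : ℕ)) = 0 := by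
      funext e
      have := hmul e
      rw [zero_mul] at this
      exact this
    have hadj := congrArg (fun w => MZ.adjugate.mulVec w) hvec
    simp only [Matrix.mulVec_mulVec, Matrix.adjugate_mul, Matrix.mulVec_zero] at hadj
    have h0 := congrFun hadj (fun _ => 0)
    simp [Matrix.smul_mulVec] at h0
    have hd : MZ.det = ((Mt.det : ℤ) : ZMod (p ^ U)) := by
      rw [hMZ]
      exact (RingHom.map_det (Int.castRingHom (ZMod (p ^ U))) Mt).symm
    rw [hd, ZMod.intCast_zmod_eq_zero_iff_dvd] at h0
    exact_mod_cast h0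
  -- step 2 : det is zero
  have hcard : Fintype.card (Fin n → Fin l) = l ^ n := by simp
  have hdet0 : Mt.det = 0 := by
    apply Int.eq_zero_of_abs_lt_dvd hdet
    refine lt_of_le_of_lt ?_ hbig
    have := Matrix.det_le (A := Mt) (abv := AbsoluteValue.abs) (x := M)
      (fun e e' => fracMat_abs_le q s _ C e e' M (hM e))
    rw [hcard] at this
    refine le_trans this ?_
    rw [mul_pow, nsmul_eq_mul]
    gcongr
    have := Nat.factorial_le_pow (l ^ n)
    exact_mod_cast this
  obtain ⟨y, hy0, hy⟩ := Matrix.exists_vecMul_eq_zero_iff.2 hdet0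
  -- step 3 : real specialization
  set ρ : Fin n → ℝ := fun i => (q i : ℝ) ^ ((1 : ℝ) / l) with hρdef
  have hρ : ∀ i, ρ i ^ l = (q i : ℝ) := by
    intro i
    rw [hρdef]
    simp only
    rw [← Real.rpow_natCast, ← Real.rpow_mul (by positivity)]
    have : (l : ℝ) ≠ 0 := by exact_mod_cast hl.ne_zero
    field_simp
    simp
  have hmulR := fracMat_mul hlpos q s (bbox n (l * L)) C ρ hρ
  set X : ℝ := ∑ v ∈ bbox n (l * L), (C v : ℝ) * ∏ i, ρ i ^ (v i * s) with hX
  have hX0 : X = 0 := by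
    have h1 : ∑ e, (y e : ℝ) * ∑ e', (Mt e e' : ℝ) * ∏ i, ρ i ^ (e' i : ℕ) = 0 := by
      simp_rw [Finset.mul_sum]
      rw [Finset.sum_comm]
      apply Finset.sum_eq_zero
      intro e' _
      have := congrFun hy e'
      simp only [Matrix.vecMul, dotProduct, Pi.zero_apply] at this
      have h2 : ∑ e, (y e : ℝ) * (Mt e e' : ℝ) = 0 := by exact_mod_cast this
      simp_rw [← mul_assoc]
      rw [← Finset.sum_mul, h2, zero_mul]
    simp_rw [hMt, hmulR] at h1
    have h2 : X * ∑ e, (y e : ℝ) * ∏ i, ρ i ^ (e i : ℕ) = 0 := by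
      rw [← h1, Finset.mul_sum]
      apply Finset.sum_congr rfl; intros; ring
    rcases mul_eq_zero.1 h2 with h | h
    · exact h
    · exfalso
      apply hy0
      have := radicals_indep hl q hq hinj ρ hρ (fun e => (y e : ℚ)) (by push_cast; exact h)
      funext e
      have := congrFun this e
      simpa using this
  have hrow := hmulR (fun _ => 0)
  rw [hX0, zero_mul] at hrow
  have hrow0 := radicals_indep hl q hq hinj ρ hρ
    (fun e' => ((fracMat l q s (bbox n (l * L)) C (fun _ => 0) e' : ℤ) : ℚ)) (by push_cast; exact hrow)
  have hent := congrFun hrow0 (fun i => ⟨(e0 i * s) % l, Nat.mod_lt _ hlpos⟩)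
  simp only [Pi.zero_apply, Int.cast_eq_zero, fracMat, Fin.val_zero, add_zero] at hent
  have hcond : ∀ v : Fin n → ℕ, (∀ i, v i * s % l = e0 i * s % l) ↔ (∀ i, v i % l = e0 i) := by
    intro v
    apply forall_congr'
    intro i
    have hc : Nat.gcd l s = 1 := (Nat.Prime.coprime_iff_not_dvd hl).2 hs
    constructor
    · intro h
      have := Nat.ModEq.cancel_right_of_coprime hc h
      rw [this, Nat.mod_eq_of_lt (e0 i).2]
    · intro h
      have : v i ≡ e0 i [MOD l] := by rw [Nat.ModEq, h, Nat.mod_eq_of_lt (e0 i).2]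
      exact this.mul_right s
  simp_rw [hcond] at hent
  rw [← Finset.sum_filter] at hent
  have hre : ∑ v ∈ (bbox n (l * L)).filter (fun v => ∀ i, v i % l = e0 i),
      C v * ∏ i, (q i : ℤ) ^ (v i * s / l)
      = ∑ m ∈ bbox n L, C (fun i => e0 i + l * m i) * ∏ i, (q i : ℤ) ^ ((e0 i + l * m i) * s / l) := by
    symm
    apply Finset.sum_nbij' (fun m i => e0 i + l * m i) (fun v i => v i / l)
    · intro m hm
      rw [mem_bbox] at hm
      simp only [Finset.mem_filter, mem_bbox]
      refine ⟨fun i => ?_, fun i => ?_⟩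
      · have := hm i; have := (e0 i).2
        calc (e0 i : ℕ) + l * m i < l * (m i + 1) := by rw [mul_add]; omega
          _ ≤ l * L := Nat.mul_le_mul_left _ (hm i)
      · rw [Nat.add_mul_mod_self_left, Nat.mod_eq_of_lt (e0 i).2]
    · intro v hv
      simp only [Finset.mem_filter, mem_bbox] at hv ⊢
      intro i
      exact Nat.div_lt_of_lt_mul (hv.1 i)
    · intro m hm
      funext i
      rw [Nat.add_mul_div_left _ _ hlpos, Nat.div_eq_of_lt (e0 i).2, zero_add]
    · intro v hv
      simp only [Finset.mem_filter] at hv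
      funext i
      rw [← hv.2 i, Nat.mod_add_div]
    · intro m hm
      rfl
  rw [hre] at hent
  have hfac : ∀ m : Fin n → ℕ, ∏ i, (q i : ℤ) ^ ((e0 i + l * m i) * s / l)
      = (∏ i, (q i : ℤ) ^ (e0 i * s / l)) * (qpow q m : ℤ) ^ s := by
    intro m
    rw [qpow]; push_cast
    rw [← Finset.prod_pow, ← Finset.prod_mul_distrib]
    apply Finset.prod_congr rfl; intro i _
    rw [← pow_mul, ← pow_add]
    congr 1
    rw [show (e0 i + l * m i) * s = e0 i * s + l * (m i * s) by ring, Nat.add_mul_div_left _ _ hlpos]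
  simp_rw [hfac] at hent
  have hne : (∏ i, (q i : ℤ) ^ (e0 i * s / l)) ≠ 0 :=
    Finset.prod_ne_zero_iff.2 fun i _ => pow_ne_zero _ (by exact_mod_cast (hq i).ne_zero)
  have : (∏ i, (q i : ℤ) ^ (e0 i * s / l)) *
      ∑ m ∈ bbox n L, C (fun i => e0 i + l * m i) * (qpow q m : ℤ) ^ s = 0 := by
    rw [← hent, Finset.mul_sum]
    apply Finset.sum_congr rfl; intros; ring
  exact (mul_eq_zero.1 this).resolve_left hne

end

section
open Polynomial

theorem div_bound {p : ℕ} [Fact p.Prime] (f : ℚ_[p][X]) (x : ℚ_[p]) (hx : ‖x‖ ≤ 1) (A r : ℝ)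
    (hA : 0 ≤ A) (hr : 0 ≤ r) (hr1 : r ≤ 1) (hf : ∀ j, ‖f.coeff j‖ ≤ A * r ^ j) :
    ∃ g : ℚ_[p][X], f = (X - C x) * g + C (f.eval x) ∧ ∀ j, ‖g.coeff j‖ ≤ (A * r) * r ^ j := by
  refine ⟨f /ₘ (X - C x), ?_, ?_⟩
  · conv_lhs => rw [← modByMonic_add_div f (X - C x)]
    rw [modByMonic_X_sub_C_eq_C_eval, add_comm]
  · intro j
    rw [coeff_divByMonic_X_sub_C]
    apply IsUltrametricDist.norm_sum_le_of_forall_le_of_nonneg (by positivity)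
    intro i hi
    rw [Finset.mem_Icc] at hi
    rw [norm_mul, norm_pow]
    calc ‖x‖ ^ (i - (j + 1)) * ‖f.coeff i‖ ≤ 1 * (A * r ^ i) := by
          gcongr
          · exact pow_le_one₀ (norm_nonneg _) hx
          · exact hf i
      _ ≤ A * r ^ (j + 1) := by
          rw [one_mul]
          gcongr A * ?_
          exact pow_le_pow_of_le_one hr hr1 hi.1
      _ = _ := by ring

theorem nodal_div_bound {p : ℕ} [Fact p.Prime] (f : ℚ_[p][X]) (r : ℝ)
    (hr : 0 ≤ r) (hr1 : r ≤ 1) (hf : ∀ j, ‖f.coeff j‖ ≤ r ^ j) (s : Finset ℕ) :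
    ∃ G g : ℚ_[p][X], f = (∏ i ∈ s, (X - C (i : ℚ_[p]))) * G + g ∧ g.degree < s.card ∧
      ∀ j, ‖G.coeff j‖ ≤ r ^ s.card * r ^ j := by
  induction s using Finset.induction_on with
  | empty => exact ⟨f, 0, by simp, by simp, by simpa using hf⟩
  | insert a s ha ih =>
    obtain ⟨G, g, h1, h2, h3⟩ := ih
    obtain ⟨G', h4, h5⟩ := div_bound G (a : ℚ_[p]) (by simpa using Padic.norm_int_le_one (a : ℤ))
      (r ^ s.card) r (by positivity) hr hr1 h3
    refine ⟨G', (∏ i ∈ s, (X - C (i : ℚ_[p]))) * C (G.eval (a : ℚ_[p])) + g, ?_, ?_, ?_⟩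
    · conv_lhs => rw [h1, h4]
      rw [Finset.prod_insert ha]; ring
    · rw [Finset.card_insert_of_notMem ha]
      refine lt_of_le_of_lt (degree_add_le _ _) (max_lt ?_ ?_)
      · refine lt_of_le_of_lt (degree_mul_le _ _) ?_
        rw [degree_prod]
        simp only [degree_X_sub_C, Finset.sum_const, nsmul_eq_mul, mul_one]
        refine lt_of_le_of_lt (add_le_add_right degree_C_le _) ?_
        simp only [add_zero]
        exact_mod_cast Nat.lt_succ_self _
      · refine lt_trans h2 ?_
        exact_mod_cast Nat.lt_succ_self _
    · rw [Finset.card_insert_of_notMem ha, pow_succ]; exact h5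

theorem norm_natCast_le_one {p : ℕ} [Fact p.Prime] (a : ℕ) : ‖(a : ℚ_[p])‖ ≤ 1 := by
  simpa using Padic.norm_int_le_one (p := p) (a : ℤ)

theorem interp_bound {p : ℕ} [Fact p.Prime] (f : ℚ_[p][X]) (r : ℝ)
    (hr : 0 ≤ r) (hr1 : r ≤ 1) (hf : ∀ j, ‖f.coeff j‖ ≤ r ^ j) (s : Finset ℕ) (δ Λ : ℝ)
    (hδ : 0 ≤ δ) (hs : s.Nonempty) (hval : ∀ i ∈ s, ‖f.eval (i : ℚ_[p])‖ ≤ δ)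
    (hΛ : ∀ i ∈ s, ∏ j ∈ s.erase i, ‖((i : ℚ_[p]) - j)‖⁻¹ ≤ Λ) (t : ℕ) :
    ‖f.eval (t : ℚ_[p])‖ ≤ max (r ^ s.card) (δ * Λ) := by
  obtain ⟨G, g, h1, h2, h3⟩ := nodal_div_bound f r hr hr1 hf s
  have hgval : ∀ i ∈ s, g.eval (i : ℚ_[p]) = f.eval (i : ℚ_[p]) := by
    intro i hi
    rw [h1, eval_add, eval_mul, eval_prod, Finset.prod_eq_zero hi (by simp)]; simp
  have hinj : Set.InjOn (fun i : ℕ => (i : ℚ_[p])) s := fun a _ b _ h => Nat.cast_injective h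
  have hint := Lagrange.eq_interpolate hinj h2
  rw [h1, eval_add]
  refine le_trans (IsUltrametricDist.norm_add_le_max _ _) (max_le_max ?_ ?_)
  · rw [eval_mul, norm_mul]
    have e1 : ‖eval (t : ℚ_[p]) (∏ i ∈ s, (X - C (i : ℚ_[p])))‖ ≤ 1 := by
      rw [eval_prod, norm_prod]
      apply Finset.prod_le_one (fun _ _ => norm_nonneg _)
      intro i _
      have := Padic.norm_int_le_one (p := p) ((t : ℤ) - i)
      simpa using this
    have e2 : ‖eval (t : ℚ_[p]) G‖ ≤ r ^ s.card := by
      rw [eval_eq_sum_range]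
      apply IsUltrametricDist.norm_sum_le_of_forall_le_of_nonneg (by positivity)
      intro j _
      rw [norm_mul, norm_pow]
      calc _ ≤ (r ^ s.card * 1) * 1 := by
            gcongr
            · exact (h3 j).trans (by gcongr; exact pow_le_one₀ hr hr1)
            · exact pow_le_one₀ (norm_nonneg _) (norm_natCast_le_one t)
        _ = _ := by ring
    calc _ ≤ 1 * r ^ s.card := by gcongr
      _ = _ := one_mul _
  · have hΛ0 : 0 ≤ Λ := by
      obtain ⟨i, hi⟩ := hs
      exact le_trans (Finset.prod_nonneg fun _ _ => by positivity) (hΛ i hi)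
    rw [hint, Lagrange.interpolate_apply, eval_finsetSum]
    apply IsUltrametricDist.norm_sum_le_of_forall_le_of_nonneg (by positivity)
    intro i hi
    rw [eval_mul, eval_C, norm_mul, hgval i hi]
    gcongr
    · exact hval i hi
    · rw [Lagrange.basis, eval_prod, norm_prod]
      refine le_trans (Finset.prod_le_prod (fun _ _ => norm_nonneg _) fun j hj => ?_) (hΛ i hi)
      simp only [Lagrange.basisDivisor, eval_mul, eval_C, eval_sub, eval_X, norm_mul, norm_inv]
      have := Padic.norm_int_le_one (p := p) ((t : ℤ) - j)
      push_cast at this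
      exact mul_le_of_le_one_right (by positivity) this

end

section
open Polynomial

theorem norm_inv_le_of_not_dvd {p : ℕ} [hp : Fact p.Prime] (m : ℤ) (a : ℕ) (h : ¬ (p : ℤ) ^ (a + 1) ∣ m) :
    ‖(m : ℚ_[p])‖⁻¹ ≤ (p : ℝ) ^ a := by
  have hp0 : (0 : ℝ) < p := by exact_mod_cast hp.out.pos
  by_contra hcon
  push Not at hcon
  apply h
  have h1 : ‖(m : ℚ_[p])‖ < (p : ℝ) ^ (-(a : ℤ)) := by
    rw [zpow_neg, zpow_natCast]
    by_cases hm : ‖(m : ℚ_[p])‖ = 0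
    · rw [hm]; positivity
    · have : 0 < ‖(m : ℚ_[p])‖ := lt_of_le_of_ne (norm_nonneg _) (Ne.symm hm)
      exact (lt_inv_comm₀ (by positivity) this).1 hcon
  have h2 : ‖(m : ℚ_[p])‖ ≤ (p : ℝ) ^ (-((a + 1 : ℕ) : ℤ)) := by
    rw [Padic.norm_le_pow_iff_norm_lt_pow_add_one]
    convert h1 using 2
    push_cast; ring
  rw [Padic.norm_int_le_pow_iff_dvd] at h2
  exact_mod_cast h2

theorem binom_trunc (z : ℤ) (K m : ℕ) :
    z ^ K ∣ (1 + z) ^ m - ∑ k ∈ Finset.range K, (m.choose k : ℤ) * z ^ k := by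
  have h : (1 + z) ^ m = ∑ k ∈ Finset.range (m + 1 + K), (m.choose k : ℤ) * z ^ k := by
    rw [add_comm, add_pow, Finset.sum_range_add _ (m + 1) K]
    rw [Finset.sum_eq_zero (s := Finset.range K), add_zero]
    · apply Finset.sum_congr rfl; intros; simp; ring
    · intro x _
      rw [Nat.choose_eq_zero_of_lt (by omega)]; simp
  rw [h, add_comm (m + 1) K, Finset.sum_range_add, add_sub_cancel_left]
  apply Finset.dvd_sum
  intro x _
  rw [pow_add]
  exact ⟨(m.choose (K + x) : ℤ) * z ^ x, by ring⟩

noncomputable def hpoly (p e K : ℕ) [Fact p.Prime] : ℚ_[p][X] :=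
  ∑ k ∈ Finset.range K, C (((p : ℚ_[p]) ^ e) ^ k / (k.factorial : ℚ_[p])) * descPochhammer ℚ_[p] k

theorem hpoly_eval (p e K m : ℕ) [Fact p.Prime] :
    (hpoly p e K).eval (m : ℚ_[p]) =
      ((∑ k ∈ Finset.range K, (m.choose k : ℤ) * ((p : ℤ) ^ e) ^ k : ℤ) : ℚ_[p]) := by
  rw [hpoly, eval_finsetSum]
  push_cast
  apply Finset.sum_congr rfl
  intro k _
  rw [eval_mul, eval_C, descPochhammer_eval_eq_descFactorial, Nat.descFactorial_eq_factorial_mul_choose]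
  have : (k.factorial : ℚ_[p]) ≠ 0 := by exact_mod_cast k.factorial_ne_zero
  push_cast
  field_simp

theorem hpoly_coeff (p e K : ℕ) [hp : Fact p.Prime] (r : ℝ) (hr : 0 ≤ r) (hr2 : r ^ 2 = (p : ℝ)⁻¹)
    (hpe : ∀ k, 2 * padicValNat p k.factorial + k ≤ 2 * e * k) (j : ℕ) :
    ‖(hpoly p e K).coeff j‖ ≤ r ^ j := by
  have hp0 : (0 : ℝ) < p := by exact_mod_cast hp.out.pos
  have hr1 : r ≤ 1 := by
    have : r ^ 2 ≤ 1 := by rw [hr2]; exact inv_le_one_of_one_le₀ (by exact_mod_cast hp.out.one_le)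
    nlinarith
  rw [hpoly, finsetSum_coeff]
  apply IsUltrametricDist.norm_sum_le_of_forall_le_of_nonneg (by positivity)
  intro k _
  rw [coeff_C_mul, norm_mul]
  by_cases hkj : k < j
  · rw [coeff_eq_zero_of_natDegree_lt (by rw [descPochhammer_natDegree]; exact hkj)]
    simp; positivity
  push Not at hkj
  have h1 : ‖(descPochhammer ℚ_[p] k).coeff j‖ ≤ 1 := by
    rw [← descPochhammer_map (Int.castRingHom ℚ_[p]), coeff_map]
    exact Padic.norm_int_le_one _
  have h2 : ‖((p : ℚ_[p]) ^ e) ^ k / (k.factorial : ℚ_[p])‖ ≤ r ^ k := by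
    rw [norm_div, norm_pow, norm_pow, Padic.norm_p]
    have h3 : ‖(k.factorial : ℚ_[p])‖ = ((p : ℝ)⁻¹) ^ (padicValNat p k.factorial) := by
      have := Padic.norm_eq_zpow_neg_valuation (p := p) (x := (k.factorial : ℚ_[p])) (by exact_mod_cast k.factorial_ne_zero)
      rw [this, Padic.valuation_natCast, zpow_neg, zpow_natCast, inv_pow]
    rw [h3, ← hr2, div_le_iff₀ (by rw [hr2]; positivity), ← pow_mul, ← pow_mul, ← pow_mul, ← pow_add]
    apply pow_le_pow_of_le_one hr hr1
    have := hpe k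
    nlinarith
  calc _ ≤ r ^ k * 1 := by gcongr
    _ ≤ r ^ j := by rw [mul_one]; exact pow_le_pow_of_le_one hr hr1 hkj

theorem factorial_val_le {p : ℕ} (hp : p.Prime) (k a : ℕ) (h : p ^ a ∣ k.factorial) : a ≤ k := by
  have := Fact.mk hp
  have h1 : a ≤ padicValNat p k.factorial :=
    (padicValNat_dvd_iff_le k.factorial_ne_zero).1 h
  have h2 := sub_one_mul_padicValNat_factorial (p := p) k
  have h3 : 1 ≤ p - 1 := by have := hp.two_le; omega
  have h4 : padicValNat p k.factorial ≤ (p - 1) * padicValNat p k.factorial :=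
    Nat.le_mul_of_pos_left _ h3
  omega

/-- value at shifted nodes -/
theorem shifted_node {ι : Type*} (Λ : Finset ι) (c : ι → ℤ) (e : ι → ℕ) (p : ℕ) (hp : p.Prime)
    (g : ℤ) (hg : (p : ℤ) ∣ g - 1) (w T s τ : ℕ) (hw : 1 ≤ w)
    (H : ∀ k < T, (p : ℤ) ^ (w * T) ∣ ∑ v ∈ Λ, c v * (e v : ℤ) ^ k * g ^ (e v * s)) :
    (p : ℤ) ^ (w * T) ∣ ∑ v ∈ Λ, c v * g ^ (e v * (s + p ^ w * τ)) := by
  have h1 : (p : ℤ) ^ w ∣ g ^ (p ^ w * τ) - 1 := by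
    have := dvd_sub_pow_of_dvd_sub (p := p) (a := g) (b := 1) hg w
    rw [one_pow] at this
    have h2 : g ^ (p ^ w) - 1 ∣ g ^ (p ^ w * τ) - 1 := by
      rw [pow_mul]; simpa using sub_dvd_pow_sub_pow (g ^ p ^ w) 1 τ
    exact (Dvd.dvd.trans (pow_dvd_pow _ (Nat.le_succ w)) this).trans h2
  obtain ⟨z, hz⟩ := h1
  have hz' : g ^ (p ^ w * τ) = 1 + (p : ℤ) ^ w * z := by linarith
  have hdesc : ∀ k < T, (p : ℤ) ^ (w * T) ∣ ∑ v ∈ Λ, c v * ((e v).descFactorial k : ℤ) * g ^ (e v * s) := by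
    intro k hk
    have : ∀ v, ((e v).descFactorial k : ℤ) = ∑ j ∈ Finset.range (k + 1), (descPochhammer ℤ k).coeff j * (e v : ℤ) ^ j := by
      intro v
      rw [← descPochhammer_eval_eq_descFactorial, eval_eq_sum_range, descPochhammer_natDegree]
    simp_rw [this, Finset.mul_sum, Finset.sum_mul]
    rw [Finset.sum_comm]
    apply Finset.dvd_sum
    intro j hj
    have hjT : j < T := by rw [Finset.mem_range] at hj; omega
    have := Dvd.dvd.mul_left (H j hjT) ((descPochhammer ℤ k).coeff j)
    rw [Finset.mul_sum] at this
    convert this using 2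
    ring
  have hch : ∀ k < T, (p : ℤ) ^ (w * T) ∣ (∑ v ∈ Λ, c v * ((e v).choose k : ℤ) * g ^ (e v * s)) * (p : ℤ) ^ (w * k) := by
    intro k hk
    have h3 := hdesc k hk
    simp_rw [Nat.descFactorial_eq_factorial_mul_choose] at h3
    set N := ∑ v ∈ Λ, c v * ((e v).choose k : ℤ) * g ^ (e v * s) with hN
    have h4 : (p : ℤ) ^ (w * T) ∣ (k.factorial : ℤ) * N := by
      convert h3 using 1
      rw [hN, Finset.mul_sum]
      apply Finset.sum_congr rfl; intros; push_cast; ring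
    have := Fact.mk hp
    obtain ⟨a, n', hn', hk'⟩ := Nat.exists_eq_pow_mul_and_not_dvd k.factorial_ne_zero p hp.ne_one
    have hak : a ≤ k := factorial_val_le hp k a ⟨n', hk'⟩
    rw [hk'] at h4
    have h5 : (p : ℤ) ^ (w * T) ∣ (n' : ℤ) * ((p : ℤ) ^ a * N) := by
      convert h4 using 1; push_cast; ring
    have hco : IsCoprime ((p : ℤ) ^ (w * T)) (n' : ℤ) := by
      apply IsCoprime.pow_left
      rw [Nat.isCoprime_iff_coprime]
      exact (Nat.Prime.coprime_iff_not_dvd hp).2 hn'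
    have h6 := hco.dvd_of_dvd_mul_left h5
    rw [mul_comm N]
    refine h6.trans (mul_dvd_mul_right (pow_dvd_pow _ ?_) _)
    nlinarith
  have hmain : ∀ v, (p : ℤ) ^ (w * T) ∣ g ^ (e v * (s + p ^ w * τ)) -
      ∑ k ∈ Finset.range T, g ^ (e v * s) * ((e v).choose k * ((p : ℤ) ^ w * z) ^ k) := by
    intro v
    have h5 := binom_trunc ((p : ℤ) ^ w * z) T (e v)
    rw [← Finset.mul_sum]
    have h6 : g ^ (e v * (s + p ^ w * τ)) = g ^ (e v * s) * (1 + (p : ℤ) ^ w * z) ^ (e v) := by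
      rw [← hz', ← pow_mul, ← pow_add]; congr 1; ring
    rw [h6, ← mul_sub]
    apply Dvd.dvd.mul_left
    refine Dvd.dvd.trans ?_ h5
    rw [mul_pow, ← pow_mul]
    exact Dvd.intro _ rfl
  have hsum : (p : ℤ) ^ (w * T) ∣ ∑ v ∈ Λ, c v * (g ^ (e v * (s + p ^ w * τ)) -
      ∑ k ∈ Finset.range T, g ^ (e v * s) * ((e v).choose k * ((p : ℤ) ^ w * z) ^ k)) :=
    Finset.dvd_sum fun v _ => Dvd.dvd.mul_left (hmain v) _
  simp_rw [mul_sub] at hsum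
  rw [Finset.sum_sub_distrib] at hsum
  refine (dvd_sub_comm.1 hsum |> fun h => (dvd_sub_right ?_).1 h)
  simp_rw [Finset.mul_sum]
  rw [Finset.sum_comm]
  apply Finset.dvd_sum
  intro k hk
  have := Dvd.dvd.mul_right (hch k (Finset.mem_range.1 hk)) (z ^ k)
  rw [Finset.sum_mul, Finset.sum_mul] at this
  convert this using 2
  rw [mul_pow, ← pow_mul]; ring

end

section
open Polynomial

theorem nodes_bound {p : ℕ} [hp : Fact p.Prime] (𝒩 : Finset ℕ) (S σ y w : ℕ) (hN : ∀ s ∈ 𝒩, s < S)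
    (hS : S ≤ p ^ y) (hσ : σ ≤ p ^ y) (hyw : y + 1 ≤ w)
    (s : Finset ℕ) (hs : s = (𝒩 ×ˢ Finset.range σ).image (fun x => x.1 + p ^ w * x.2)) :
    s.card = 𝒩.card * σ ∧ ∀ i ∈ s, ∏ j ∈ s.erase i, ‖((i : ℚ_[p]) - j)‖⁻¹ ≤ (p : ℝ) ^ (y * (S * σ) + w * σ) := by
  have hp1 : (1 : ℝ) ≤ p := by exact_mod_cast hp.out.one_le
  have hNcard : 𝒩.card ≤ S := by
    calc 𝒩.card ≤ (Finset.range S).card := Finset.card_le_card fun x hx => Finset.mem_range.2 (hN x hx)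
      _ = S := Finset.card_range S
  have hSw : S ≤ p ^ w := hS.trans (Nat.pow_le_pow_right hp.out.pos (by omega))
  have hmod : ∀ a ∈ 𝒩, ∀ b, (a + p ^ w * b) % p ^ w = a := fun a ha b => by
    rw [Nat.add_mul_mod_self_left, Nat.mod_eq_of_lt (lt_of_lt_of_le (hN a ha) hSw)]
  have hpw : 0 < p ^ w := pow_pos hp.out.pos _
  have hinj : Set.InjOn (fun x : ℕ × ℕ => x.1 + p ^ w * x.2) (𝒩 ×ˢ Finset.range σ : Finset (ℕ × ℕ)) := by
    rintro ⟨a, b⟩ h1 ⟨a', b'⟩ h2 h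
    simp only [Finset.coe_product, Set.mem_prod, Finset.mem_coe] at h1 h2
    simp only at h
    have ha : a = a' := by rw [← hmod a h1.1 b, ← hmod a' h2.1 b', h]
    subst ha
    have : p ^ w * b = p ^ w * b' := by omega
    rw [Nat.eq_of_mul_eq_mul_left hpw this]
  have hcard : s.card = 𝒩.card * σ := by
    rw [hs, Finset.card_image_of_injOn hinj]; simp
  refine ⟨hcard, ?_⟩
  intro i hi
  have hi' := hi
  rw [hs, Finset.mem_image] at hi'
  obtain ⟨⟨a, b⟩, hab, rfl⟩ := hi'
  simp only [Finset.mem_product, Finset.mem_range] at hab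
  simp only
  have hsmall : ∀ u v : ℕ, u < p ^ y → v < p ^ y → (p : ℤ) ^ (y + 1) ∣ (u : ℤ) - v → u = v := by
    intro u v hu hv hd
    have : (u : ℤ) - v = 0 := by
      apply Int.eq_zero_of_abs_lt_dvd hd
      have h1 : (u : ℤ) < (p : ℤ) ^ y := by exact_mod_cast hu
      have h2 : (v : ℤ) < (p : ℤ) ^ y := by exact_mod_cast hv
      have h3 : (p : ℤ) ^ y ≤ (p : ℤ) ^ (y + 1) :=
        pow_le_pow_right₀ (by exact_mod_cast hp.out.one_le) (Nat.le_succ y)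
      rw [abs_lt]; constructor <;> omega
    omega
  have hterm : ∀ j ∈ s.erase (a + p ^ w * b), ‖((a + p ^ w * b : ℕ) : ℚ_[p]) - j‖⁻¹ ≤
      (p : ℝ) ^ y * (if j % p ^ w = a then (p : ℝ) ^ w else 1) := by
    intro j hj
    rw [Finset.mem_erase] at hj
    obtain ⟨hne, hj⟩ := hj
    rw [hs, Finset.mem_image] at hj
    obtain ⟨⟨a', b'⟩, hab', rfl⟩ := hj
    simp only [Finset.mem_product, Finset.mem_range] at hab'
    simp only at hne ⊢
    rw [hmod a' hab'.1]
    have hcast : ((a + p ^ w * b : ℕ) : ℚ_[p]) - ((a' + p ^ w * b' : ℕ) : ℚ_[p]) =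
      ((((a : ℤ) - a') + (p : ℤ) ^ w * ((b : ℤ) - b') : ℤ) : ℚ_[p]) := by push_cast; ring
    rw [hcast]
    split_ifs with h
    · rw [← pow_add]
      apply norm_inv_le_of_not_dvd
      subst h
      rw [sub_self, zero_add, add_comm y w, add_assoc, pow_add]
      intro hd
      have := Int.dvd_of_mul_dvd_mul_left (by exact_mod_cast hpw.ne') hd
      have := hsmall b b' (by omega) (by omega) this
      subst this
      exact hne rfl
    · rw [mul_one]
      apply norm_inv_le_of_not_dvd
      intro hd
      have h1 : (p : ℤ) ^ (y + 1) ∣ (p : ℤ) ^ w * ((b : ℤ) - b') :=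
        Dvd.dvd.mul_right (pow_dvd_pow _ hyw) _
      have h2 := (dvd_add_left h1).1 hd
      exact h (hsmall a a' (lt_of_lt_of_le (hN a hab.1) hS) (lt_of_lt_of_le (hN a' hab'.1) hS) h2).symm
  refine le_trans (Finset.prod_le_prod (fun _ _ => by positivity) hterm) ?_
  rw [Finset.prod_mul_distrib, Finset.prod_const, Finset.prod_ite, Finset.prod_const, Finset.prod_const, one_pow,
    mul_one, ← pow_mul, ← pow_mul, ← pow_add]
  apply pow_le_pow_right₀ hp1
  apply Nat.add_le_add
  · apply Nat.mul_le_mul_left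
    calc _ ≤ s.card := Finset.card_le_card (Finset.erase_subset _ _)
      _ = 𝒩.card * σ := hcard
      _ ≤ _ := Nat.mul_le_mul_right _ hNcard
  · apply Nat.mul_le_mul_left
    calc _ ≤ ((Finset.range σ).image (fun x => a + p ^ w * x)).card := by
          apply Finset.card_le_card
          intro j hj
          rw [Finset.mem_filter, Finset.mem_erase] at hj
          obtain ⟨⟨hne, hj⟩, hja⟩ := hj
          rw [hs, Finset.mem_image] at hj
          obtain ⟨⟨a', b'⟩, hab', rfl⟩ := hj
          simp only [Finset.mem_product, Finset.mem_range] at hab'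
          simp only at hja
          rw [hmod a' hab'.1] at hja
          subst hja
          exact Finset.mem_image.2 ⟨b', Finset.mem_range.2 hab'.2, rfl⟩
      _ ≤ σ := by simpa using Finset.card_image_le (s := Finset.range σ) (f := fun x => a + p ^ w * x)

theorem extrap {ι : Type*} (Λ : Finset ι) (c : ι → ℤ) (e : ι → ℕ) (p : ℕ) (hp : p.Prime)
    (ee : ℕ) (hee : 1 ≤ ee) (hpe : ∀ k, 2 * padicValNat p k.factorial + k ≤ 2 * ee * k)
    (𝒩 : Finset ℕ) (S σ' y w : ℕ) (hN : ∀ s ∈ 𝒩, s < S) (hN2 : S ≤ 2 * 𝒩.card) (hS1 : 1 ≤ S)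
    (hσ1 : 1 ≤ σ')
    (hS : S ≤ p ^ y) (hσ : 4 * σ' ≤ p ^ y) (hw : w = 2 * S * (y + 1))
    (H : ∀ s ∈ 𝒩, ∀ k < 8 * σ', (p : ℤ) ^ (w * (8 * σ')) ∣
      ∑ v ∈ Λ, c v * (e v : ℤ) ^ k * (1 + (p : ℤ) ^ ee) ^ (e v * s)) (t : ℕ) :
    (p : ℤ) ^ (S * σ') ∣ ∑ v ∈ Λ, c v * (1 + (p : ℤ) ^ ee) ^ (e v * t) := by
  have := Fact.mk hp
  have hp1 : (1 : ℝ) ≤ p := by exact_mod_cast hp.one_le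
  have hp0 : (0 : ℝ) < p := by linarith
  have hyw : y + 1 ≤ w := by rw [hw]; nlinarith
  have hw1 : 1 ≤ w := by omega
  set g : ℤ := 1 + (p : ℤ) ^ ee with hg
  set K := w * (8 * σ') with hK
  set r : ℝ := Real.sqrt ((p : ℝ)⁻¹) with hr
  have hr0 : 0 ≤ r := Real.sqrt_nonneg _
  have hr2 : r ^ 2 = (p : ℝ)⁻¹ := Real.sq_sqrt (by positivity)
  have hr1 : r ≤ 1 := by
    rw [hr]; exact Real.sqrt_le_one.2 (inv_le_one_of_one_le₀ hp1)
  set FI : ℕ → ℤ := fun t => ∑ v ∈ Λ, c v * ∑ k ∈ Finset.range K, ((e v * t).choose k : ℤ) * ((p : ℤ) ^ ee) ^ k with hFI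
  have hcong : ∀ t, (p : ℤ) ^ K ∣ (∑ v ∈ Λ, c v * g ^ (e v * t)) - FI t := by
    intro t
    rw [hFI, ← Finset.sum_sub_distrib]
    apply Finset.dvd_sum
    intro v _
    rw [← mul_sub]
    apply Dvd.dvd.mul_left
    refine Dvd.dvd.trans ?_ (binom_trunc ((p : ℤ) ^ ee) K (e v * t))
    exact pow_dvd_pow_of_dvd (dvd_pow_self _ (by omega)) _
  set f : ℚ_[p][X] := ∑ v ∈ Λ, C ((c v : ℤ) : ℚ_[p]) * (hpoly p ee K).comp (C ((e v : ℕ) : ℚ_[p]) * X) with hf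
  have hfe : ∀ t : ℕ, f.eval (t : ℚ_[p]) = ((FI t : ℤ) : ℚ_[p]) := by
    intro t
    rw [hf, eval_finsetSum, hFI]
    simp only
    rw [Int.cast_sum]
    apply Finset.sum_congr rfl
    intro v _
    rw [eval_mul, eval_C, eval_comp, eval_mul, eval_C, eval_X, Int.cast_mul]
    congr 1
    have := hpoly_eval p ee K (e v * t)
    rw [← this]; push_cast; rfl
  have hfc : ∀ j, ‖f.coeff j‖ ≤ r ^ j := by
    intro j
    rw [hf, finsetSum_coeff]
    apply IsUltrametricDist.norm_sum_le_of_forall_le_of_nonneg (by positivity)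
    intro v _
    rw [coeff_C_mul, comp_C_mul_X_coeff, norm_mul, norm_mul, norm_pow]
    have h1 : ‖((c v : ℤ) : ℚ_[p])‖ ≤ 1 := Padic.norm_int_le_one _
    have h2 : ‖((e v : ℕ) : ℚ_[p])‖ ^ j ≤ 1 := pow_le_one₀ (norm_nonneg _) (norm_natCast_le_one _)
    have h3 := hpoly_coeff p ee K r hr0 hr2 hpe j
    calc _ ≤ 1 * (r ^ j * 1) := by gcongr
      _ = _ := by ring
  set s : Finset ℕ := (𝒩 ×ˢ Finset.range (4 * σ')).image (fun x => x.1 + p ^ w * x.2) with hs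
  obtain ⟨hcard, hprod⟩ := nodes_bound 𝒩 S (4 * σ') y w hN hS hσ hyw s hs
  have hNpos : 0 < 𝒩.card := by omega
  have hne : s.Nonempty := by
    rw [← Finset.card_pos, hcard]; positivity
  have hval : ∀ i ∈ s, ‖f.eval (i : ℚ_[p])‖ ≤ ((p : ℝ) ^ K)⁻¹ := by
    intro i hi
    rw [hs, Finset.mem_image] at hi
    obtain ⟨⟨a, b⟩, hab, rfl⟩ := hi
    simp only [Finset.mem_product, Finset.mem_range] at hab
    rw [hfe]
    have h1 := shifted_node Λ c e p hp g (by rw [hg, add_sub_cancel_left]; exact dvd_pow_self _ (by omega))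
      w (8 * σ') a b hw1 (H a hab.1)
    have h2 := (dvd_sub_right h1).1 (hcong (a + p ^ w * b))
    have h3 := (Padic.norm_int_le_pow_iff_dvd (p := p) (FI (a + p ^ w * b)) K).2 (by exact_mod_cast h2)
    rwa [zpow_neg, zpow_natCast] at h3
  have hfin := interp_bound f r hr0 hr1 hfc s _ _ (by positivity) hne hval hprod t
  have hle : max (r ^ s.card) (((p : ℝ) ^ K)⁻¹ * (p : ℝ) ^ (y * (S * (4 * σ')) + w * (4 * σ')))
      ≤ ((p : ℝ) ^ (S * σ'))⁻¹ := by
    apply max_le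
    · rw [← inv_pow, ← hr2, ← pow_mul, hcard]
      apply pow_le_pow_of_le_one hr0 hr1
      nlinarith
    · rw [inv_mul_le_iff₀ (by positivity), ← div_eq_mul_inv, le_div_iff₀ (by positivity), ← pow_add]
      apply pow_le_pow_right₀ hp1
      rw [hK, hw]
      nlinarith [Nat.zero_le (S * σ' * y), Nat.zero_le (S * σ')]
  have h4 := hfin.trans hle
  rw [hfe, ← zpow_natCast, ← zpow_neg, Padic.norm_int_le_pow_iff_dvd] at h4
  have h5 : (p : ℤ) ^ (S * σ') ∣ FI t := by exact_mod_cast h4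
  have h6 : (p : ℤ) ^ (S * σ') ∣ (p : ℤ) ^ K := by
    apply pow_dvd_pow
    rw [hK, hw]
    nlinarith [Nat.zero_le (S * σ' * y), Nat.zero_le (S * σ')]
  exact (dvd_sub_left h5).1 (h6.trans (hcong t))

end

section

def gam {n : ℕ} (b : Fin n → ℤ) (i0 j : Fin n) (v : Fin n → ℕ) : ℤ := b i0 * v j - b j * v i0

theorem prod_zpow_sum {G ι : Type*} [CommGroup G] (g : G) (s : Finset ι) (z : ι → ℤ) :
    ∏ i ∈ s, g ^ z i = g ^ ∑ i ∈ s, z i := by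
  classical
  induction s using Finset.induction_on with
  | empty => simp
  | insert a s ha ih => rw [Finset.prod_insert ha, Finset.sum_insert ha, zpow_add, ih]

theorem dlog_exists {p ee V : ℕ} (hp : p.Prime) (hee : ee ≠ 0) (hpm : ee + 2 ≤ p * ee)
    (hV : ee ≤ V) (x : ZMod (p ^ V)) (m0 : ℤ) (hx : x = 1 + (p : ZMod (p ^ V)) ^ ee * (m0 : ZMod (p ^ V))) :
    orderOf (1 + (p : ZMod (p ^ V)) ^ ee) = p ^ (V - ee) ∧ ∃ e : ℕ, (1 + (p : ZMod (p ^ V)) ^ ee) ^ e = x := by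
  obtain ⟨N, rfl⟩ : ∃ N, V = N + ee := ⟨V - ee, by omega⟩
  have hord := ZMod.orderOf_one_add_mul_prime_pow hp ee hee hpm 1
    (by intro h; have := Int.eq_one_of_dvd_one (by positivity) h; exact hp.ne_one (by exact_mod_cast this)) N
  rw [Int.cast_one, mul_one] at hord
  refine ⟨by rw [hord]; simp, ?_⟩
  set g := (1 + (p : ZMod (p ^ (N + ee))) ^ ee) with hg
  have hred : ∀ M : ℤ, ∃ m < p ^ N, (1 + (p : ZMod (p ^ (N + ee))) ^ ee * (M : ZMod (p ^ (N + ee))))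
      = 1 + (p : ZMod (p ^ (N + ee))) ^ ee * (m : ZMod (p ^ (N + ee))) := by
    intro M
    have hpos : (0 : ℤ) < (p : ℤ) ^ N := by have := hp.pos; positivity
    refine ⟨(M % (p : ℤ) ^ N).toNat, ?_, ?_⟩
    · have := Int.emod_lt_of_pos M hpos
      have h2 := Int.emod_nonneg M hpos.ne'
      zify; rw [Int.toNat_of_nonneg h2]; exact_mod_cast this
    · have h2 := Int.emod_nonneg M hpos.ne'
      congr 1
      have h3 : (((p : ℤ) ^ ee * M : ℤ) : ZMod (p ^ (N + ee))) = (((p : ℤ) ^ ee * ((M % (p : ℤ) ^ N).toNat : ℤ) : ℤ) : ZMod (p ^ (N + ee))) := by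
        rw [ZMod.intCast_eq_intCast_iff_dvd_sub, Int.toNat_of_nonneg h2, ← mul_sub]
        push_cast
        rw [pow_add, mul_comm]
        apply mul_dvd_mul_left
        rw [dvd_sub_comm]
        exact Int.dvd_self_sub_emod
      push_cast at h3
      exact h3
  have hgp : ∀ i : ℕ, ∃ M : ℤ, g ^ i = 1 + (p : ZMod (p ^ (N + ee))) ^ ee * (M : ZMod (p ^ (N + ee))) := by
    intro i
    have : ((p : ℤ) ^ ee) ∣ (1 + (p : ℤ) ^ ee) ^ i - 1 := by
      have := sub_dvd_pow_sub_pow (1 + (p : ℤ) ^ ee) 1 i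
      simpa using this
    obtain ⟨M, hM⟩ := this
    refine ⟨M, ?_⟩
    have h2 : (1 + (p : ℤ) ^ ee) ^ i = 1 + (p : ℤ) ^ ee * M := by linarith
    have h3 := congrArg (Int.cast : ℤ → ZMod (p ^ (N + ee))) h2
    push_cast at h3
    exact h3
  set I1 := (Finset.range (p ^ N)).image (fun i => g ^ i) with hI1
  set I2 := (Finset.range (p ^ N)).image (fun m : ℕ => 1 + (p : ZMod (p ^ (N + ee))) ^ ee * (m : ZMod (p ^ (N + ee)))) with hI2
  have hsub : I1 ⊆ I2 := by
    intro z hz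
    rw [hI1, Finset.mem_image] at hz
    obtain ⟨i, _, rfl⟩ := hz
    obtain ⟨M, hM⟩ := hgp i
    obtain ⟨m, hm, hmM⟩ := hred M
    rw [hI2, Finset.mem_image]
    exact ⟨m, Finset.mem_range.2 hm, by rw [hM, hmM]⟩
  have hc1 : I1.card = p ^ N := by
    rw [hI1, Finset.card_image_of_injOn, Finset.card_range]
    intro a ha c hc h
    simp only [Finset.coe_range, Set.mem_Iio] at ha hc
    exact pow_injOn_Iio_orderOf (x := g) (by rw [Set.mem_Iio, hord]; exact ha) (by rw [Set.mem_Iio, hord]; exact hc) h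
  have hcard : I2.card ≤ I1.card := by
    rw [hc1]
    calc I2.card ≤ (Finset.range (p ^ N)).card := Finset.card_image_le
      _ = _ := Finset.card_range _
  have heq := Finset.eq_of_subset_of_card_le hsub hcard
  obtain ⟨m, hm, hmM⟩ := hred m0
  have : x ∈ I1 := by
    rw [heq, hI2, Finset.mem_image]
    exact ⟨m, Finset.mem_range.2 hm, by rw [hx, hmM]⟩
  rw [hI1, Finset.mem_image] at this
  obtain ⟨i, _, hi⟩ := this
  exact ⟨i, hi⟩

theorem dlog_units {p ee V : ℕ} (hp : p.Prime) (hee : ee ≠ 0) (hpm : ee + 2 ≤ p * ee)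
    (hV : ee ≤ V) : ∃ g : (ZMod (p ^ V))ˣ, (g : ZMod (p ^ V)) = 1 + (p : ZMod (p ^ V)) ^ ee ∧
      orderOf g = p ^ (V - ee) ∧ ∀ (x y : (ZMod (p ^ V))ˣ) (a b : ℕ), (x : ZMod (p ^ V)) = a →
        (y : ZMod (p ^ V)) = b → a ≡ b [MOD p ^ ee] → ∃ e : ℕ, x = y * g ^ e := by
  have h1 := (dlog_exists hp hee hpm hV 1 0 (by simp)).1
  have hgu : IsUnit (1 + (p : ZMod (p ^ V)) ^ ee) := by
    apply IsUnit.of_pow_eq_one (n := p ^ (V - ee)) _ (pow_pos hp.pos _).ne'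
    rw [← h1]; exact pow_orderOf_eq_one _
  refine ⟨hgu.unit, hgu.unit_spec, ?_, ?_⟩
  · rw [← h1, ← orderOf_units, hgu.unit_spec]
  · intro x y a b hx hy hab
    have hz : ∃ m0 : ℤ, (((x * y⁻¹ : (ZMod (p ^ V))ˣ)) : ZMod (p ^ V)) = 1 + (p : ZMod (p ^ V)) ^ ee * (m0 : ZMod (p ^ V)) := by
      obtain ⟨k, hk⟩ := (Nat.modEq_iff_dvd.1 hab.symm)
      have hNe : NeZero (p ^ V) := ⟨(pow_pos hp.pos _).ne'⟩
      refine ⟨k * (((y⁻¹ : (ZMod (p ^ V))ˣ) : ZMod (p ^ V)).val : ℤ), ?_⟩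
      have h2 : (x : ZMod (p ^ V)) = y + (p : ZMod (p ^ V)) ^ ee * (k : ZMod (p ^ V)) := by
        rw [hx, hy]
        have h3 : (a : ℤ) = b + (p : ℤ) ^ ee * k := by push_cast at hk; linarith
        have h4 := congrArg (Int.cast : ℤ → ZMod (p ^ V)) h3
        push_cast at h4; exact h4
      push_cast
      rw [ZMod.natCast_zmod_val, h2, add_mul, Units.mul_inv]; ring
    obtain ⟨m0, hm0⟩ := hz
    obtain ⟨e, he⟩ := (dlog_exists hp hee hpm hV _ m0 hm0).2
    refine ⟨e, ?_⟩
    have : hgu.unit ^ e = x * y⁻¹ := by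
      apply Units.ext; rw [Units.val_pow_eq_pow_val, hgu.unit_spec, he]
    rw [this]; simp

theorem dlog_main {n p ee V : ℕ} (hp : p.Prime) (hee : ee ≠ 0) (hpm : ee + 2 ≤ p * ee)
    (hV : ee ≤ V) (q : Fin n → ℕ) (hq : ∀ i, (q i).Prime) (hqp : ∀ i, q i ≠ p)
    (b : Fin n → ℤ) (i0 : Fin n)
    (hb : ∏ i, q i ^ (b i).toNat ≡ ∏ i, q i ^ (-b i).toNat [MOD p ^ V]) :
    ∃ Lg : Fin n → ℤ, ∀ v v0 : Fin n → ℕ, qpow q v ≡ qpow q v0 [MOD p ^ ee] →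
      ∃ e : ℕ, (qpow q v : ℤ) ≡ qpow q v0 * (1 + (p : ℤ) ^ ee) ^ e [ZMOD (p : ℤ) ^ V] ∧
        (b i0 * Nat.totient (p ^ ee)) * (e : ℤ) ≡ ∑ j, Lg j * (gam b i0 j v - gam b i0 j v0)
          [ZMOD (p : ℤ) ^ (V - ee)] := by
  obtain ⟨g, hg, hord, hlog⟩ := dlog_units hp hee hpm hV
  have hc : ∀ i k, Nat.Coprime (q i) (p ^ k) := fun i k =>
    Nat.Coprime.pow_right _ ((Nat.coprime_primes (hq i) hp).2 (hqp i))
  set Q : Fin n → (ZMod (p ^ V))ˣ := fun i => ZMod.unitOfCoprime (q i) (hc i V) with hQ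
  have hQv : ∀ i, ((Q i : (ZMod (p ^ V))ˣ) : ZMod (p ^ V)) = (q i : ZMod (p ^ V)) := fun i => by simp [hQ]
  set φ := Nat.totient (p ^ ee) with hφ
  have hL : ∀ i, ∃ L : ℕ, Q i ^ φ = g ^ L := by
    intro i
    obtain ⟨e, he⟩ := hlog (Q i ^ φ) 1 (q i ^ φ) 1 (by rw [Units.val_pow_eq_pow_val, hQv]; simp) (by simp)
      (Nat.ModEq.pow_totient (hc i ee))
    exact ⟨e, by rw [he, one_mul]⟩
  choose L hL using hL
  have hqv : ∀ v : Fin n → ℕ, ((∏ i, Q i ^ v i : (ZMod (p ^ V))ˣ) : ZMod (p ^ V)) = (qpow q v : ℕ) := by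
    intro v
    rw [Units.coe_prod, qpow]; push_cast
    apply Finset.prod_congr rfl; intro i _
    rw [hQv]
  have hord' : ∀ z : ℤ, g ^ z = 1 → (p : ℤ) ^ (V - ee) ∣ z := by
    intro z hz
    have := orderOf_dvd_iff_zpow_eq_one.2 hz
    rw [hord] at this; exact_mod_cast this
  have hrel : ∏ i, Q i ^ b i = 1 := by
    have h1 : (∏ i, Q i ^ (b i).toNat) = ∏ i, Q i ^ (-b i).toNat := by
      apply Units.ext
      rw [hqv (fun i => (b i).toNat), hqv (fun i => (-b i).toNat)]
      exact (ZMod.natCast_eq_natCast_iff _ _ _).2 hb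
    have h2 : ∀ i, Q i ^ b i = Q i ^ (b i).toNat * (Q i ^ (-b i).toNat)⁻¹ := by
      intro i
      rw [← zpow_natCast, ← zpow_natCast, ← zpow_neg, ← zpow_add, ← sub_eq_add_neg, Int.toNat_sub_toNat_neg]
    simp_rw [h2]
    rw [Finset.prod_mul_distrib, h1, ← Finset.prod_mul_distrib]
    simp
  have hrelL : (p : ℤ) ^ (V - ee) ∣ ∑ i, (L i : ℤ) * b i := by
    apply hord'
    have h1 : ∏ i, (Q i ^ φ) ^ b i = 1 := by
      have := congrArg (fun z => z ^ φ) hrel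
      simp only [one_pow] at this
      rw [← this, ← Finset.prod_pow]
      apply Finset.prod_congr rfl; intro i _
      rw [← zpow_natCast, ← zpow_natCast, ← zpow_mul, ← zpow_mul, mul_comm]
    simp_rw [hL, ← zpow_natCast, ← zpow_mul] at h1
    rw [← h1, prod_zpow_sum]
  refine ⟨fun i => L i, fun v v0 hvv => ?_⟩
  obtain ⟨e, he⟩ := hlog (∏ i, Q i ^ v i) (∏ i, Q i ^ v0 i) _ _ (hqv v) (hqv v0) hvv
  refine ⟨e, ?_, ?_⟩
  · have h1 := congrArg Units.val he
    rw [Units.val_mul, hqv, hqv, Units.val_pow_eq_pow_val, hg] at h1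
    have h2 := (ZMod.intCast_eq_intCast_iff (qpow q v : ℤ) (qpow q v0 * (1 + (p : ℤ) ^ ee) ^ e) (p ^ V)).1
      (by push_cast; exact h1)
    exact_mod_cast h2
  · have h3 : (p : ℤ) ^ (V - ee) ∣ (φ : ℤ) * e - ∑ i, (L i : ℤ) * ((v i : ℤ) - v0 i) := by
      apply hord'
      rw [zpow_sub, zpow_mul, zpow_natCast, zpow_natCast]
      have h4 : g ^ e = ∏ i, Q i ^ ((v i : ℤ) - v0 i) := by
        simp_rw [zpow_sub, zpow_natCast]
        rw [Finset.prod_mul_distrib, he, Finset.prod_inv_distrib]; simp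
      rw [← pow_mul, mul_comm φ e, pow_mul, h4, ← Finset.prod_pow]
      have h5 : ∀ i, (Q i ^ ((v i : ℤ) - v0 i)) ^ φ = g ^ ((L i : ℤ) * ((v i : ℤ) - v0 i)) := by
        intro i
        rw [zpow_mul, zpow_natCast, ← hL, ← zpow_natCast, ← zpow_natCast, ← zpow_mul, ← zpow_mul, mul_comm]
      simp_rw [h5]
      rw [prod_zpow_sum]; simp
    rw [Int.modEq_iff_dvd, dvd_sub_comm]
    have h6 : b i0 * (φ : ℤ) * e - ∑ j, (L j : ℤ) * (gam b i0 j v - gam b i0 j v0) =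
        b i0 * ((φ : ℤ) * e - ∑ i, (L i : ℤ) * ((v i : ℤ) - v0 i)) + ((v i0 : ℤ) - v0 i0) * ∑ i, (L i : ℤ) * b i := by
      have h7 : ∑ j, (L j : ℤ) * (gam b i0 j v - gam b i0 j v0) =
        b i0 * (∑ i, (L i : ℤ) * ((v i : ℤ) - v0 i)) - ((v i0 : ℤ) - v0 i0) * ∑ i, (L i : ℤ) * b i := by
        rw [Finset.mul_sum, Finset.mul_sum, ← Finset.sum_sub_distrib]
        apply Finset.sum_congr rfl; intro j _
        simp only [gam]; ring
      rw [h7]; ring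
    rw [h6]
    exact dvd_add (Dvd.dvd.mul_left h3 _) (Dvd.dvd.mul_left hrelL _)

end

section

def mon {n : ℕ} (b : Fin n → ℤ) (i0 : Fin n) (m : Fin n → ℕ) (v : Fin n → ℕ) : ℤ :=
  ∏ j, gam b i0 j v ^ m j

def Van {n : ℕ} (q : Fin n → ℕ) (b : Fin n → ℤ) (i0 : Fin n) (L : ℕ) (c : (Fin n → ℕ) → ℤ)
    (T : ℕ) (𝒩 : Finset ℕ) : Prop :=
  ∀ s ∈ 𝒩, ∀ m : Fin n → ℕ, ∑ j, m j ≤ T →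
    ∑ v ∈ bbox n L, c v * mon b i0 m v * (qpow q v : ℤ) ^ s = 0

theorem Van.poly {n : ℕ} {q : Fin n → ℕ} {b : Fin n → ℤ} {i0 : Fin n} {L : ℕ} {c : (Fin n → ℕ) → ℤ}
    {T : ℕ} {𝒩 : Finset ℕ} (h : Van q b i0 L c T 𝒩) (F : MvPolynomial (Fin n) ℤ)
    (hF : F.totalDegree ≤ T) (s : ℕ) (hs : s ∈ 𝒩) :
    ∑ v ∈ bbox n L, c v * MvPolynomial.eval (fun j => gam b i0 j v) F * (qpow q v : ℤ) ^ s = 0 := by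
  simp_rw [MvPolynomial.eval_eq', Finset.mul_sum, Finset.sum_mul]
  rw [Finset.sum_comm]
  apply Finset.sum_eq_zero
  intro d hd
  have h1 := h s hs d (by
    refine le_trans ?_ ((MvPolynomial.le_totalDegree hd).trans hF)
    rw [Finsupp.sum_fintype _ _ (by simp)])
  have : ∀ v, c v * (F.coeff d * ∏ i, gam b i0 i v ^ d i) * (qpow q v : ℤ) ^ s =
      F.coeff d * (c v * mon b i0 d v * (qpow q v : ℤ) ^ s) := by intro v; rw [mon]; ring
  simp_rw [this]
  rw [← Finset.mul_sum, h1, mul_zero]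

theorem Van.mono {n : ℕ} {q : Fin n → ℕ} {b : Fin n → ℤ} {i0 : Fin n} {L : ℕ} {c : (Fin n → ℕ) → ℤ}
    {T T' : ℕ} {𝒩 : Finset ℕ} (h : Van q b i0 L c T 𝒩) (hT : T' ≤ T) : Van q b i0 L c T' 𝒩 :=
  fun s hs m hm => h s hs m (hm.trans hT)

theorem pow_dvd_of_small {p : ℕ} (hp : p.Prime) (D N : ℤ) (hD : D ≠ 0) (f X a : ℕ)
    (hDf : |D| ≤ (p : ℤ) ^ f) (ha : f + X ≤ a) (h : (p : ℤ) ^ a ∣ D * N) : (p : ℤ) ^ X ∣ N := by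
  have hpZ : Prime (p : ℤ) := Nat.prime_iff_prime_int.1 hp
  have hfin : FiniteMultiplicity (p : ℤ) D :=
    Int.finiteMultiplicity_iff.2 ⟨by simpa using hp.ne_one, hD⟩
  obtain ⟨D', hD', hnd⟩ := hfin.exists_eq_pow_mul_and_not_dvd
  set v := multiplicity (p : ℤ) D with hv
  have hvf : v ≤ f := by
    have h1 : (p : ℤ) ^ v ≤ |D| := Int.le_of_dvd (abs_pos.2 hD) ((dvd_abs _ _).2 ⟨D', hD'⟩)
    have h2 : p ^ v ≤ p ^ f := by exact_mod_cast h1.trans hDf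
    exact (Nat.pow_le_pow_iff_right hp.one_lt).1 h2
  have h3 : (p : ℤ) ^ (v + X) ∣ D * N := (pow_dvd_pow _ (by omega)).trans h
  rw [hD', pow_add, mul_assoc] at h3
  have h4 := (mul_dvd_mul_iff_left (pow_ne_zero v hpZ.ne_zero)).1 h3
  exact (IsCoprime.pow_left ((Prime.coprime_iff_not_dvd hpZ).2 hnd)).dvd_of_dvd_mul_left h4

theorem totalDegree_lin_pow {n : ℕ} (Lg : Fin n → ℤ) (a : Fin n → ℤ) (k : ℕ) :
    ((∑ j, MvPolynomial.C (Lg j) * (MvPolynomial.X j - MvPolynomial.C (a j)) : MvPolynomial (Fin n) ℤ) ^ k).totalDegree ≤ k := by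
  refine (MvPolynomial.totalDegree_pow _ _).trans ?_
  have : (∑ j, MvPolynomial.C (Lg j) * (MvPolynomial.X j - MvPolynomial.C (a j)) : MvPolynomial (Fin n) ℤ).totalDegree ≤ 1 := by
    apply MvPolynomial.totalDegree_finsetSum_le
    intro j _
    refine (MvPolynomial.totalDegree_mul _ _).trans ?_
    rw [MvPolynomial.totalDegree_C, zero_add]
    refine (MvPolynomial.totalDegree_sub _ _).trans ?_
    rw [MvPolynomial.totalDegree_C, MvPolynomial.totalDegree_X]; simp
  nlinarith

theorem div_step {n p ee V : ℕ} (hp : p.Prime) (hee : ee ≠ 0) (hpm : ee + 2 ≤ p * ee)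
    (hpe : ∀ k, 2 * padicValNat p k.factorial + k ≤ 2 * ee * k)
    (q : Fin n → ℕ) (hq : ∀ i, (q i).Prime) (hqp : ∀ i, q i ≠ p)
    (b : Fin n → ℤ) (i0 : Fin n) (hb0 : b i0 ≠ 0)
    (hb : ∏ i, q i ^ (b i).toNat ≡ ∏ i, q i ^ (-b i).toNat [MOD p ^ V])
    (d : ℕ) (hd : |b i0 * Nat.totient (p ^ ee)| ≤ (p : ℤ) ^ d)
    (L : ℕ) (c : (Fin n → ℕ) → ℤ)
    (hcl : ∀ v ∈ bbox n L, ∀ v' ∈ bbox n L, c v ≠ 0 → c v' ≠ 0 → qpow q v ≡ qpow q v' [MOD p ^ ee])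
    (T T' : ℕ) (𝒩 : Finset ℕ) (hVan : Van q b i0 L c T 𝒩)
    (S σ' y : ℕ) (hN : ∀ s ∈ 𝒩, s < S) (hN2 : S ≤ 2 * 𝒩.card) (hS1 : 1 ≤ S)
    (hσ1 : 1 ≤ σ') (hS : S ≤ p ^ y) (hσ : 4 * σ' ≤ p ^ y)
    (hT : T' + 8 * σ' ≤ T)
    (hV : ee + 8 * σ' * (d + 2 * S * (y + 1)) ≤ V)
    (m : Fin n → ℕ) (hm : ∑ j, m j ≤ T') (t : ℕ) :
    (p : ℤ) ^ (S * σ') ∣ ∑ v ∈ bbox n L, c v * mon b i0 m v * (qpow q v : ℤ) ^ t := by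
  classical
  have hpZ : Prime (p : ℤ) := Nat.prime_iff_prime_int.1 hp
  by_cases hex : ∃ v0 ∈ bbox n L, c v0 ≠ 0
  swap
  · push Not at hex
    rw [Finset.sum_eq_zero]; · simp
    intro v hv; rw [hex v hv]; simp
  obtain ⟨v0, hv0, hcv0⟩ := hex
  have hVee : ee ≤ V := by omega
  obtain ⟨Lg, hLg⟩ := dlog_main hp hee hpm hVee q hq hqp b i0 hb
  have hev : ∀ v : Fin n → ℕ, ∃ e : ℕ, v ∈ bbox n L → c v ≠ 0 →
      (qpow q v : ℤ) ≡ qpow q v0 * (1 + (p : ℤ) ^ ee) ^ e [ZMOD (p : ℤ) ^ V] ∧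
        (b i0 * Nat.totient (p ^ ee)) * (e : ℤ) ≡ ∑ j, Lg j * (gam b i0 j v - gam b i0 j v0)
          [ZMOD (p : ℤ) ^ (V - ee)] := by
    intro v
    by_cases h : v ∈ bbox n L ∧ c v ≠ 0
    · obtain ⟨e, he⟩ := hLg v v0 (hcl v h.1 v0 hv0 h.2 hcv0)
      exact ⟨e, fun _ _ => he⟩
    · exact ⟨0, fun h1 h2 => absurd ⟨h1, h2⟩ h⟩
  choose e he using hev
  set x0 : ℤ := ((qpow q v0 : ℕ) : ℤ) with hx0
  have hx0p : ∀ s, IsCoprime ((p : ℤ)) (x0 ^ s) := by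
    intro s
    apply IsCoprime.pow_right
    rw [hx0, Nat.isCoprime_iff_coprime, qpow]
    apply Nat.Coprime.prod_right
    intro i _
    exact Nat.Coprime.pow_right _ ((Nat.coprime_primes hp (hq i)).2 (hqp i).symm)
  set D : ℤ := b i0 * Nat.totient (p ^ ee) with hD
  have hD0 : D ≠ 0 := mul_ne_zero hb0 (by
    have := Nat.totient_pos.2 (pow_pos hp.pos ee)
    exact_mod_cast this.ne')
  set G : ℤ := 1 + (p : ℤ) ^ ee with hG
  set w := 2 * S * (y + 1) with hw
  set X := w * (8 * σ') with hX
  have hcong : ∀ v ∈ bbox n L, ∀ s, (p : ℤ) ^ V ∣ c v * mon b i0 m v * (qpow q v : ℤ) ^ s - x0 ^ s * (c v * mon b i0 m v * G ^ (e v * s)) := by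
    intro v hv s
    by_cases hc : c v = 0
    · rw [hc]; simp
    have h1 := ((he v hv hc).1.pow s).symm.dvd
    rw [mul_pow, ← pow_mul] at h1
    have := Dvd.dvd.mul_left h1 (c v * mon b i0 m v)
    rw [show c v * mon b i0 m v * (qpow q v : ℤ) ^ s - x0 ^ s * (c v * mon b i0 m v * G ^ (e v * s)) =
      c v * mon b i0 m v * ((qpow q v : ℤ) ^ s - x0 ^ s * G ^ (e v * s)) by ring]
    exact this
  have H : ∀ s ∈ 𝒩, ∀ k < 8 * σ', (p : ℤ) ^ (w * (8 * σ')) ∣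
      ∑ v ∈ bbox n L, (c v * mon b i0 m v) * (e v : ℤ) ^ k * G ^ (e v * s) := by
    intro s hs k hk
    set N := ∑ v ∈ bbox n L, (c v * mon b i0 m v) * (e v : ℤ) ^ k * G ^ (e v * s) with hNdef
    have hzero := hVan.poly ((∏ j, MvPolynomial.X j ^ m j) *
        (∑ j, MvPolynomial.C (Lg j) * (MvPolynomial.X j - MvPolynomial.C (gam b i0 j v0)) : MvPolynomial (Fin n) ℤ) ^ k) (by
        refine (MvPolynomial.totalDegree_mul _ _).trans ?_
        have h1 := totalDegree_lin_pow Lg (fun j => gam b i0 j v0) k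
        have h2 : (∏ j, MvPolynomial.X j ^ m j : MvPolynomial (Fin n) ℤ).totalDegree ≤ ∑ j, m j := by
          refine (MvPolynomial.totalDegree_finsetProd _ _).trans (Finset.sum_le_sum fun j _ => ?_)
          rw [MvPolynomial.totalDegree_X_pow]
        omega) s hs
    have hdvd : (p : ℤ) ^ (V - ee) ∣ D ^ k * (x0 ^ s * N) := by
      have h3 : (p : ℤ) ^ (V - ee) ∣ D ^ k * (x0 ^ s * N) - 0 := by
        rw [← hzero, hNdef, Finset.mul_sum, Finset.mul_sum, ← Finset.sum_sub_distrib]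
        apply Finset.dvd_sum
        intro v hv
        by_cases hc : c v = 0
        · rw [hc]; simp
        have h4 := (he v hv hc).2.pow k
        have h5 : x0 ^ s * G ^ (e v * s) ≡ (qpow q v : ℤ) ^ s [ZMOD (p : ℤ) ^ (V - ee)] := by
          have := ((he v hv hc).1.pow s).symm
          rw [mul_pow, ← pow_mul] at this
          exact this.of_dvd (pow_dvd_pow _ (by omega))
        have h6 := ((h4.mul h5).mul_left (c v * mon b i0 m v)).symm.dvd
        simp only [map_mul, map_prod, map_pow, map_sum, map_sub, MvPolynomial.eval_X, MvPolynomial.eval_C]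
        rw [show D ^ k * (x0 ^ s * (c v * mon b i0 m v * (e v : ℤ) ^ k * G ^ (e v * s))) =
          c v * mon b i0 m v * ((D * (e v : ℤ)) ^ k * (x0 ^ s * G ^ (e v * s))) by ring]
        rw [show c v * ((∏ x, gam b i0 x v ^ m x) * (∑ x, Lg x * (gam b i0 x v - gam b i0 x v0)) ^ k) * (qpow q v : ℤ) ^ s =
          c v * mon b i0 m v * ((∑ x, Lg x * (gam b i0 x v - gam b i0 x v0)) ^ k * (qpow q v : ℤ) ^ s) by rw [mon]; ring]
        exact h6
      simpa using h3
    have h7 : (p : ℤ) ^ X ∣ x0 ^ s * N := by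
      apply pow_dvd_of_small hp (D ^ k) (x0 ^ s * N) (pow_ne_zero _ hD0) (d * k) X (V - ee) _ _ hdvd
      · rw [abs_pow, pow_mul]; gcongr
      · have : d * k ≤ 8 * σ' * d := by nlinarith
        have h8 : 8 * σ' * (d + w) = 8 * σ' * d + X := by rw [hX]; ring
        omega
    exact (IsCoprime.pow_left (hx0p s)).dvd_of_dvd_mul_left h7
  have hext := extrap (bbox n L) (fun v => c v * mon b i0 m v) e p hp ee (by omega) hpe 𝒩 S σ' y w hN hN2 hS1 hσ1 hS hσ hw H t
  have hSV : S * σ' ≤ V := by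
    have : S * σ' ≤ 8 * σ' * (d + w) := by
      rw [hw]; nlinarith [Nat.zero_le (S * σ' * y), Nat.zero_le (S * σ'), Nat.zero_le (σ' * d)]
    omega
  have hsum : (p : ℤ) ^ (S * σ') ∣ ∑ v ∈ bbox n L, (c v * mon b i0 m v * (qpow q v : ℤ) ^ t - x0 ^ t * (c v * mon b i0 m v * G ^ (e v * t))) :=
    Finset.dvd_sum fun v hv => (pow_dvd_pow _ hSV).trans (hcong v hv t)
  rw [Finset.sum_sub_distrib, ← Finset.mul_sum] at hsum
  exact (dvd_sub_left (Dvd.dvd.mul_left hext _)).1 hsum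

end

section

structure Ctx (n p ee V l d W : ℕ) (q : Fin n → ℕ) (b : Fin n → ℤ) (i0 : Fin n) : Prop where
  hp : p.Prime
  hee : ee ≠ 0
  hpm : ee + 2 ≤ p * ee
  hpe : ∀ k, 2 * padicValNat p k.factorial + k ≤ 2 * ee * k
  hq : ∀ i, (q i).Prime
  hqp : ∀ i, q i ≠ p
  hinj : Function.Injective q
  hb0 : b i0 ≠ 0
  hb : ∏ i, q i ^ (b i).toNat ≡ ∏ i, q i ^ (-b i).toNat [MOD p ^ V]
  hd : |b i0 * Nat.totient (p ^ ee)| ≤ (p : ℤ) ^ d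
  hl : l.Prime
  hlp : ¬ l ∣ p * (p - 1)
  hW : ∏ i, q i ≤ p ^ W

theorem mon_abs_le {n p d L T : ℕ} (hp : 0 < p) (b : Fin n → ℤ) (i0 : Fin n)
    (hgam : ∀ v ∈ bbox n L, ∀ j, |gam b i0 j v| ≤ (p : ℤ) ^ d) (m : Fin n → ℕ) (hm : ∑ j, m j ≤ T)
    (v : Fin n → ℕ) (hv : v ∈ bbox n L) : |mon b i0 m v| ≤ (p : ℤ) ^ (d * T) := by
  rw [mon, Finset.abs_prod]
  calc ∏ j, |gam b i0 j v ^ m j| ≤ ∏ j, ((p : ℤ) ^ d) ^ m j := by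
        apply Finset.prod_le_prod (fun _ _ => abs_nonneg _)
        intro j _
        rw [abs_pow]
        exact pow_le_pow_left₀ (abs_nonneg _) (hgam v hv j) _
    _ = (p : ℤ) ^ (d * ∑ j, m j) := by
        rw [Finset.prod_pow_eq_pow_sum, ← pow_mul]
    _ ≤ _ := pow_le_pow_right₀ (by exact_mod_cast hp) (Nat.mul_le_mul_left _ hm)

theorem prod_q_pow_le {n p W : ℕ} (q : Fin n → ℕ) (hq : ∀ i, 0 < q i) (hW : ∏ i, q i ≤ p ^ W)
    (f : Fin n → ℕ) (N : ℕ) (hf : ∀ i, f i ≤ N) : ∏ i, (q i : ℤ) ^ f i ≤ (p : ℤ) ^ (W * N) := by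
  have : ∏ i, q i ^ f i ≤ p ^ (W * N) := by
    calc ∏ i, q i ^ f i ≤ ∏ i, q i ^ N :=
          Finset.prod_le_prod' fun i _ => Nat.pow_le_pow_right (hq i) (hf i)
      _ = (∏ i, q i) ^ N := Finset.prod_pow _ _ _
      _ ≤ (p ^ W) ^ N := Nat.pow_le_pow_left hW _
      _ = _ := by rw [pow_mul]
  exact_mod_cast this

theorem size_bound {n p d W L T η E : ℕ} (hp : 0 < p) (q : Fin n → ℕ) (b : Fin n → ℤ) (i0 : Fin n)
    (hq : ∀ i, 0 < q i) (hW : ∏ i, q i ≤ p ^ W)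
    (hgam : ∀ v ∈ bbox n L, ∀ j, |gam b i0 j v| ≤ (p : ℤ) ^ d) (c : (Fin n → ℕ) → ℤ) (H : ℤ) (hH0 : 0 ≤ H)
    (hH : ∀ v ∈ bbox n L, |c v| ≤ H) (hη : (L : ℤ) ^ n * H ≤ (p : ℤ) ^ η)
    (m : Fin n → ℕ) (hm : ∑ j, m j ≤ T) (f : (Fin n → ℕ) → Fin n → ℕ)
    (hf : ∀ v ∈ bbox n L, ∀ i, f v i ≤ E) :
    ∑ v ∈ bbox n L, |c v * mon b i0 m v| * ∏ i, (q i : ℤ) ^ f v i ≤ (p : ℤ) ^ (η + d * T + W * E) := by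
  calc _ ≤ ∑ v ∈ bbox n L, H * (p : ℤ) ^ (d * T) * (p : ℤ) ^ (W * E) := by
        apply Finset.sum_le_sum
        intro v hv
        rw [abs_mul]
        have h1 := mon_abs_le hp b i0 hgam m hm v hv
        have h2 := prod_q_pow_le q hq hW (f v) E (hf v hv)
        have h3 := hH v hv
        gcongr
    _ = ((L : ℤ) ^ n * H) * ((p : ℤ) ^ (d * T) * (p : ℤ) ^ (W * E)) := by
        rw [Finset.sum_const, card_bbox, nsmul_eq_mul]; push_cast; ring
    _ ≤ (p : ℤ) ^ η * ((p : ℤ) ^ (d * T) * (p : ℤ) ^ (W * E)) := by gcongr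
    _ = _ := by rw [pow_add, pow_add]; ring

theorem inner_loop {n p ee V l d W : ℕ} {q : Fin n → ℕ} {b : Fin n → ℤ} {i0 : Fin n}
    (X : Ctx n p ee V l d W q b i0) (L : ℕ) (c : (Fin n → ℕ) → ℤ)
    (hcl : ∀ v ∈ bbox n L, ∀ v' ∈ bbox n L, c v ≠ 0 → c v' ≠ 0 → qpow q v ≡ qpow q v' [MOD p ^ ee])
    (H : ℤ) (hH0 : 0 ≤ H) (hH : ∀ v ∈ bbox n L, |c v| ≤ H) (η : ℕ) (hη : (L : ℤ) ^ n * H ≤ (p : ℤ) ^ η)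
    (hgam : ∀ v ∈ bbox n L, ∀ j, |gam b i0 j v| ≤ (p : ℤ) ^ d)
    (T T' S y k : ℕ) (𝒩 : Finset ℕ) (hVan : Van q b i0 L c T 𝒩)
    (hN : ∀ s ∈ 𝒩, s < S) (hN2 : S ≤ 2 * 𝒩.card) (hS1 : 1 ≤ S) (hL : 1 ≤ L) (hW1 : 1 ≤ W)
    (hbig : η + d * T < 4 * W * L * S) (hTT : T' + 8 * (6 * W * L) * (k + 1) ≤ T)
    (hV : ee + 8 * (6 * W * L) * (d + 2 * (S * 2 ^ k) * (y + 1)) ≤ V)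
    (hy1 : S * 2 ^ k ≤ p ^ y) (hy2 : 4 * (6 * W * L) ≤ p ^ y) (m : Fin n → ℕ) (hm : ∑ j, m j ≤ T') (t : ℕ) :
    (p : ℤ) ^ (S * 2 ^ k * (6 * W * L)) ∣ ∑ v ∈ bbox n L, c v * mon b i0 m v * (qpow q v : ℤ) ^ t := by
  set σ' := 6 * W * L with hσ'
  have hσ1 : 1 ≤ σ' := by
    have : 1 ≤ W * L := Nat.mul_pos hW1 hL
    rw [hσ', mul_assoc]; omega
  have hstep : ∀ i ≤ k, ∃ 𝒩i : Finset ℕ, (∀ s ∈ 𝒩i, s < S * 2 ^ i) ∧ S * 2 ^ i ≤ 2 * 𝒩i.card ∧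
      Van q b i0 L c (T - 8 * σ' * i) 𝒩i := by
    intro i
    induction i with
    | zero => intro _; exact ⟨𝒩, by simpa using hN, by simpa using hN2, by simpa using hVan⟩
    | succ i ih =>
      intro hi
      obtain ⟨𝒩i, h1, h2, h3⟩ := ih (by omega)
      refine ⟨Finset.range (S * 2 ^ (i + 1)), fun s hs => Finset.mem_range.1 hs, by rw [Finset.card_range]; omega, ?_⟩
      intro s hs m hm
      rw [Finset.mem_range] at hs
      have hik : 2 ^ i ≤ 2 ^ k := Nat.pow_le_pow_right (by norm_num) (by omega)
      have hSik : S * 2 ^ i ≤ S * 2 ^ k := Nat.mul_le_mul_left _ hik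
      have hi1 : 8 * σ' * (i + 1) ≤ 8 * σ' * (k + 1) := Nat.mul_le_mul_left _ (by omega)
      have hi2 : 8 * σ' * (i + 1) = 8 * σ' * i + 8 * σ' := by ring
      have hdv := div_step X.hp X.hee X.hpm X.hpe q X.hq X.hqp b i0 X.hb0 X.hb d X.hd L c hcl
        (T - 8 * σ' * i) (T - 8 * σ' * (i + 1)) 𝒩i h3 (S * 2 ^ i) σ' y h1 h2
        (Nat.mul_pos hS1 (by positivity)) hσ1 (hSik.trans hy1) hy2 (by omega)
        (by
          refine le_trans ?_ hV
          gcongr) m hm s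
      apply Int.eq_zero_of_abs_lt_dvd hdv
      have hsz := size_bound X.hp.pos q b i0 (fun i => (X.hq i).pos) X.hW hgam c H hH0 hH hη m
        (hm.trans (Nat.sub_le _ _)) (fun v i => v i * s) (E := L * s)
        (fun v hv i => Nat.mul_le_mul_right _ (mem_bbox.1 hv i).le)
      refine lt_of_le_of_lt ((Finset.abs_sum_le_sum_abs _ _).trans (le_trans (le_of_eq ?_) hsz)) ?_
      · apply Finset.sum_congr rfl
        intro v _
        rw [abs_mul, qpow]
        congr 1
        push_cast
        rw [← Finset.prod_pow, Finset.abs_prod]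
        apply Finset.prod_congr rfl
        intro i _
        rw [← pow_mul, abs_of_nonneg (by positivity)]
      · apply pow_lt_pow_right₀ (by exact_mod_cast X.hp.one_lt)
        have e1 : W * (L * s) ≤ W * (L * (S * 2 ^ (i + 1))) := by gcongr
        have e2 : W * (L * (S * 2 ^ (i + 1))) = 2 * (W * L * S * 2 ^ i) := by ring
        have e3 : 4 * W * L * S ≤ 4 * (W * L * S * 2 ^ i) := by
          have : 1 ≤ 2 ^ i := Nat.one_le_two_pow
          nlinarith [Nat.zero_le (W * L * S)]
        have e4 : S * 2 ^ i * σ' = 6 * (W * L * S * 2 ^ i) := by rw [hσ']; ring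
        omega
  obtain ⟨𝒩i, h1, h2, h3⟩ := hstep k le_rfl
  have hi2 : 8 * σ' * (k + 1) = 8 * σ' * k + 8 * σ' := by ring
  exact div_step X.hp X.hee X.hpm X.hpe q X.hq X.hqp b i0 X.hb0 X.hb d X.hd L c hcl
        (T - 8 * σ' * k) T' 𝒩i h3 (S * 2 ^ k) σ' y h1 h2
        (Nat.mul_pos hS1 (by positivity)) hσ1 hy1 hy2 (by omega) hV m hm t

theorem gam_affine {n : ℕ} (b : Fin n → ℤ) (i0 j : Fin n) (l : ℕ) (e m : Fin n → ℕ) :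
    gam b i0 j (fun i => e i + l * m i) = gam b i0 j e + l * gam b i0 j m := by
  simp only [gam]; push_cast; ring

theorem card_coprime_nodes {l S : ℕ} (hl : l.Prime) (hS : l ∣ S) :
    S ≤ 2 * ((Finset.range S).filter (fun s => ¬ l ∣ s)).card := by
  have h1 := Finset.card_filter_add_card_filter_not (s := Finset.range S) (fun s => l ∣ s)
  obtain ⟨K, rfl⟩ := hS
  have h2 : ((Finset.range (l * K)).filter (fun s => l ∣ s)).card ≤ K := by
    calc _ ≤ ((Finset.range K).image (fun x => l * x)).card := by
          apply Finset.card_le_card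
          intro x hx
          rw [Finset.mem_filter, Finset.mem_range] at hx
          obtain ⟨hx, ⟨z, rfl⟩⟩ := hx
          exact Finset.mem_image.2 ⟨z, Finset.mem_range.2 (Nat.lt_of_mul_lt_mul_left hx), rfl⟩
      _ ≤ _ := Finset.card_image_le.trans (by simp)
  rw [Finset.card_range] at h1
  have := hl.two_le
  nlinarith

theorem stage {n p ee V l d W : ℕ} {q : Fin n → ℕ} {b : Fin n → ℤ} {i0 : Fin n}
    (X : Ctx n p ee V l d W q b i0) (L' : ℕ) (c : (Fin n → ℕ) → ℤ)
    (hcl : ∀ v ∈ bbox n (l * L'), ∀ v' ∈ bbox n (l * L'), c v ≠ 0 → c v' ≠ 0 → qpow q v ≡ qpow q v' [MOD p ^ ee])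
    (hne : ∃ v ∈ bbox n (l * L'), c v ≠ 0)
    (H : ℤ) (hH0 : 0 ≤ H) (hH : ∀ v ∈ bbox n (l * L'), |c v| ≤ H) (η : ℕ)
    (hη : ((l * L' : ℕ) : ℤ) ^ n * H ≤ (p : ℤ) ^ η)
    (hgam : ∀ v ∈ bbox n (l * L'), ∀ j, |gam b i0 j v| ≤ (p : ℤ) ^ d)
    (T T' S y k : ℕ)
    (hVan : Van q b i0 (l * L') c T ((Finset.range S).filter (fun s => ¬ l ∣ s)))
    (hlS : l ∣ S) (hS1 : 1 ≤ S) (hL : 1 ≤ L') (hW1 : 1 ≤ W) (hlk : l ^ n ≤ 2 ^ k) (hld : l ≤ p ^ d)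
    (hbig : n * d + η + d * T < 4 * W * (l * L') * S) (hTT : T' + 8 * (6 * W * (l * L')) * (k + 1) ≤ T)
    (hV : ee + 8 * (6 * W * (l * L')) * (d + 2 * (S * 2 ^ k) * (y + 1)) ≤ V)
    (hy1 : S * 2 ^ k ≤ p ^ y) (hy2 : 4 * (6 * W * (l * L')) ≤ p ^ y) :
    ∃ c' : (Fin n → ℕ) → ℤ,
      (∀ v ∈ bbox n L', ∀ v' ∈ bbox n L', c' v ≠ 0 → c' v' ≠ 0 → qpow q v ≡ qpow q v' [MOD p ^ ee]) ∧
      (∃ v ∈ bbox n L', c' v ≠ 0) ∧ (∀ v ∈ bbox n L', |c' v| ≤ H) ∧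
      Van q b i0 L' c' T' ((Finset.range (l * S)).filter (fun s => ¬ l ∣ s)) := by
  have hl := X.hl
  have hlpos := hl.pos
  obtain ⟨v1, hv1, hcv1⟩ := hne
  set e0 : Fin n → Fin l := fun i => ⟨v1 i % l, Nat.mod_lt _ hlpos⟩ with he0
  have hmem : ∀ m ∈ bbox n L', (fun i => (e0 i : ℕ) + l * m i) ∈ bbox n (l * L') := by
    intro m hm
    rw [mem_bbox] at hm ⊢
    intro i
    have := (e0 i).2
    calc (e0 i : ℕ) + l * m i < l * (m i + 1) := by rw [mul_add]; omega
      _ ≤ l * L' := Nat.mul_le_mul_left _ (hm i)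
  have hdiv := inner_loop X (l * L') c hcl H hH0 hH η hη hgam T T' S y k _ hVan
    (fun s hs => Finset.mem_range.1 (Finset.mem_filter.1 hs).1) (card_coprime_nodes hl hlS) hS1
    (Nat.mul_pos hlpos hL) hW1 (by omega) hTT hV hy1 hy2
  have hzero : ∀ s < l * S, ¬ l ∣ s → ∀ m : Fin n → ℕ, ∑ j, m j ≤ T' →
      ∑ u ∈ bbox n L', c (fun i => e0 i + l * u i) * mon b i0 m (fun i => e0 i + l * u i) * (qpow q u : ℤ) ^ s = 0 := by
    intro s hs hls m hm
    have hsz : ∀ e : Fin n → Fin l,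
      ∑ v ∈ bbox n (l * L'), |c v * mon b i0 m v| * ∏ i, (q i : ℤ) ^ ((v i * s + e i) / l) ≤ (p : ℤ) ^ (η + d * T' + W * (l * L' * S)) := by
      intro e
      apply size_bound X.hp.pos q b i0 (fun i => (X.hq i).pos) X.hW hgam c H hH0 hH hη m hm
        (fun v i => (v i * s + e i) / l)
      intro v hv i
      have h1 := mem_bbox.1 hv i
      have h2 := (e i).2
      have h3 : (v i * s + e i) / l < l * L' * S := by
        apply Nat.div_lt_of_lt_mul
        have h4 : v i * s ≤ v i * (l * S) := Nat.mul_le_mul_left _ hs.le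
        have h5 : (v i + 1) * (l * S) ≤ (l * L') * (l * S) := Nat.mul_le_mul_right _ h1
        have h6 : l ≤ l * S := Nat.le_mul_of_pos_right _ hS1
        have h7 : (v i + 1) * (l * S) = v i * (l * S) + l * S := by ring
        have h8 : (l * L') * (l * S) = l * (l * L' * S) := by ring
        omega
      exact h3.le
    refine frac_step X.hp hl X.hlp q X.hq X.hqp X.hinj (fun v => c v * mon b i0 m v) hls
      (fun t => hdiv m hm t) _ hsz ?_ e0
    have e1 : ((l : ℤ) ^ n * (p : ℤ) ^ (η + d * T' + W * (l * L' * S))) ≤ (p : ℤ) ^ (n * d + η + d * T' + W * (l * L' * S)) := by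
      rw [show n * d + η + d * T' + W * (l * L' * S) = d * n + (η + d * T' + W * (l * L' * S)) by ring, pow_add _ (d * n), pow_mul]
      gcongr
      exact_mod_cast hld
    calc _ ≤ ((p : ℤ) ^ (n * d + η + d * T' + W * (l * L' * S))) ^ (l ^ n) := pow_le_pow_left₀ (by positivity) e1 _
      _ = (p : ℤ) ^ ((n * d + η + d * T' + W * (l * L' * S)) * l ^ n) := by rw [pow_mul]
      _ < _ := by
        apply pow_lt_pow_right₀ (by exact_mod_cast X.hp.one_lt)
        have hTT' : d * T' ≤ d * T := Nat.mul_le_mul_left _ (by omega)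
        have h1 : n * d + η + d * T' + W * (l * L' * S) < 5 * (W * (l * L') * S) := by
          have : W * (l * L' * S) = W * (l * L') * S := by ring
          have : 4 * W * (l * L') * S = 4 * (W * (l * L') * S) := by ring
          omega
        have h2 : 0 < l ^ n := pow_pos hlpos _
        calc _ < 5 * (W * (l * L') * S) * l ^ n := Nat.mul_lt_mul_of_pos_right h1 h2
          _ ≤ 5 * (W * (l * L') * S) * 2 ^ k := Nat.mul_le_mul_left _ hlk
          _ ≤ _ := by
            rw [show S * 2 ^ k * (6 * W * (l * L')) = 6 * (W * (l * L') * S) * 2 ^ k by ring]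
            gcongr; omega
  refine ⟨fun u => c (fun i => e0 i + l * u i), ?_, ?_, ?_, ?_⟩
  · intro v hv v' hv' h1 h2
    have h3 := hcl _ (hmem v hv) _ (hmem v' hv') h1 h2
    have hsplit : ∀ u : Fin n → ℕ, qpow q (fun i => e0 i + l * u i) = qpow q (fun i => (e0 i : ℕ)) * (qpow q u) ^ l := by
      intro u
      simp only [qpow]
      rw [← Finset.prod_pow, ← Finset.prod_mul_distrib]
      apply Finset.prod_congr rfl; intro i _
      rw [pow_add, ← pow_mul, mul_comm l]
    rw [hsplit, hsplit] at h3
    have hcop : ∀ u : Fin n → ℕ, Nat.Coprime (p ^ ee) (qpow q u) := by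
      intro u
      apply Nat.Coprime.pow_left
      rw [qpow]
      apply Nat.Coprime.prod_right
      intro i _
      exact Nat.Coprime.pow_right _ ((Nat.coprime_primes X.hp (X.hq i)).2 (X.hqp i).symm)
    have h4 := Nat.ModEq.cancel_left_of_coprime (hcop _) h3
    have hct : Nat.Coprime l (Nat.totient (p ^ ee)) := by
      rw [Nat.totient_prime_pow X.hp (Nat.pos_of_ne_zero X.hee), Nat.Prime.coprime_iff_not_dvd hl]
      intro h
      rcases hl.dvd_mul.1 h with h | h
      · exact X.hlp (Dvd.dvd.mul_right (hl.dvd_of_dvd_pow h) _)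
      · exact X.hlp (Dvd.dvd.mul_left h _)
    have h5 : ∀ u : Fin n → ℕ, ((ZMod.unitOfCoprime (qpow q u) (hcop u).symm : (ZMod (p ^ ee))ˣ) : ZMod (p ^ ee)) = (qpow q u : ℕ) := fun u => by simp
    have h6 : (ZMod.unitOfCoprime (qpow q v) (hcop v).symm) ^ l = (ZMod.unitOfCoprime (qpow q v') (hcop v').symm) ^ l := by
      apply Units.ext
      rw [Units.val_pow_eq_pow_val, Units.val_pow_eq_pow_val, h5, h5]
      exact_mod_cast (ZMod.natCast_eq_natCast_iff _ _ _).2 h4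
    have hct' : (Nat.card (ZMod (p ^ ee))ˣ).Coprime l := by
      have : NeZero (p ^ ee) := ⟨(pow_pos X.hp.pos _).ne'⟩
      rw [Nat.card_eq_fintype_card, ZMod.card_units_eq_totient]; exact hct.symm
    have h7 := (powCoprime hct').injective (a₁ := ZMod.unitOfCoprime (qpow q v) (hcop v).symm)
      (a₂ := ZMod.unitOfCoprime (qpow q v') (hcop v').symm) (by simpa [powCoprime] using h6)
    have h8 := congrArg Units.val h7
    rw [h5, h5] at h8
    exact (ZMod.natCast_eq_natCast_iff _ _ _).1 h8
  · refine ⟨fun i => v1 i / l, ?_, ?_⟩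
    · rw [mem_bbox] at hv1 ⊢
      exact fun i => Nat.div_lt_of_lt_mul (hv1 i)
    · have : (fun i => (e0 i : ℕ) + l * (v1 i / l)) = v1 := by
        funext i; simp [he0, Nat.mod_add_div]
      simp only [this]; exact hcv1
  · intro v hv; exact hH _ (hmem v hv)
  · intro s hs m hm
    rw [Finset.mem_filter, Finset.mem_range] at hs
    -- Van for shifted polynomials
    have hVan' : ∀ F : MvPolynomial (Fin n) ℤ, F.totalDegree ≤ T' →
        ∑ u ∈ bbox n L', c (fun i => e0 i + l * u i) *
          MvPolynomial.eval (fun j => gam b i0 j (fun i => e0 i + l * u i)) F * (qpow q u : ℤ) ^ s = 0 := by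
      intro F hF
      simp_rw [MvPolynomial.eval_eq', Finset.mul_sum, Finset.sum_mul]
      rw [Finset.sum_comm]
      apply Finset.sum_eq_zero
      intro dd hdd
      have h1 := hzero s hs.1 hs.2 dd (by
        refine le_trans ?_ ((MvPolynomial.le_totalDegree hdd).trans hF)
        rw [Finsupp.sum_fintype _ _ (by simp)])
      have : ∀ u : Fin n → ℕ, c (fun i => e0 i + l * u i) * (F.coeff dd * ∏ x, gam b i0 x (fun i => e0 i + l * u i) ^ dd x) * (qpow q u : ℤ) ^ s =
        F.coeff dd * (c (fun i => e0 i + l * u i) * mon b i0 dd (fun i => e0 i + l * u i) * (qpow q u : ℤ) ^ s) := by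
        intro v; rw [mon]; ring
      simp_rw [this]
      rw [← Finset.mul_sum, h1, mul_zero]
    have h9 := hVan' (∏ j, (MvPolynomial.X j - MvPolynomial.C (gam b i0 j (fun i => (e0 i : ℕ)))) ^ m j) (by
      refine (MvPolynomial.totalDegree_finsetProd _ _).trans (le_trans (Finset.sum_le_sum fun j _ => ?_) hm)
      refine (MvPolynomial.totalDegree_pow _ _).trans ?_
      have : (MvPolynomial.X j - MvPolynomial.C (gam b i0 j (fun i => (e0 i : ℕ))) : MvPolynomial (Fin n) ℤ).totalDegree ≤ 1 := by
        refine (MvPolynomial.totalDegree_sub _ _).trans ?_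
        rw [MvPolynomial.totalDegree_C, MvPolynomial.totalDegree_X]; simp
      nlinarith)
    have h10 : ∀ u : Fin n → ℕ, MvPolynomial.eval (fun j => gam b i0 j (fun i => e0 i + l * u i))
        (∏ j, (MvPolynomial.X j - MvPolynomial.C (gam b i0 j (fun i => (e0 i : ℕ)))) ^ m j : MvPolynomial (Fin n) ℤ)
        = (l : ℤ) ^ (∑ j, m j) * mon b i0 m u := by
      intro u
      simp only [map_prod, map_pow, map_sub, MvPolynomial.eval_X, MvPolynomial.eval_C]
      rw [mon, ← Finset.prod_pow_eq_pow_sum, ← Finset.prod_mul_distrib]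
      apply Finset.prod_congr rfl; intro j _
      rw [gam_affine, add_sub_cancel_left, mul_pow]
    simp_rw [h10] at h9
    have h11 : (l : ℤ) ^ (∑ j, m j) * ∑ u ∈ bbox n L', c (fun i => e0 i + l * u i) * mon b i0 m u * (qpow q u : ℤ) ^ s = 0 := by
      rw [← h9, Finset.mul_sum]
      apply Finset.sum_congr rfl; intros; ring
    exact (mul_eq_zero.1 h11).resolve_left (pow_ne_zero _ (by exact_mod_cast hl.ne_zero))

end

section

theorem gam_self {n : ℕ} (b : Fin n → ℤ) (i0 : Fin n) (v : Fin n → ℕ) : gam b i0 i0 v = 0 := by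
  simp [gam]

theorem siegel_class {n p ee Q : ℕ} (hp : p.Prime) (q : Fin n → ℕ) (hq : ∀ i, (q i).Prime)
    (hqp : ∀ i, q i ≠ p) (N : ℕ) (hN : Nat.totient (p ^ ee) * N ≤ Q ^ n) :
    ∃ G ⊆ bbox n Q, N ≤ G.card ∧ ∀ v ∈ G, ∀ v' ∈ G, qpow q v ≡ qpow q v' [MOD p ^ ee] := by
  classical
  haveI : NeZero (p ^ ee) := ⟨pow_ne_zero _ hp.ne_zero⟩
  have hco : ∀ v : Fin n → ℕ, Nat.Coprime (qpow q v) (p ^ ee) := by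
    intro v
    apply Nat.Coprime.pow_right
    rw [qpow]
    apply Nat.Coprime.prod_left
    intro i _
    exact Nat.Coprime.pow_left _ ((Nat.coprime_primes (hq i) hp).2 (hqp i))
  obtain ⟨y, -, hy⟩ := Finset.exists_le_card_fiber_of_mul_le_card_of_maps_to
    (s := bbox n Q) (t := (Finset.univ : Finset (ZMod (p ^ ee))ˣ)) (n := N)
    (f := fun v => ZMod.unitOfCoprime (qpow q v) (hco v)) (fun _ _ => Finset.mem_univ _)
    ⟨1, Finset.mem_univ _⟩
    (by rw [Finset.card_univ, ZMod.card_units_eq_totient, card_bbox]; exact hN)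
  refine ⟨_, Finset.filter_subset _ _, hy, ?_⟩
  intro v hv v' hv'
  have h1 := (Finset.mem_filter.1 hv).2
  have h2 := (Finset.mem_filter.1 hv').2
  have h3 := congrArg (fun u : (ZMod (p ^ ee))ˣ => (u : ZMod (p ^ ee))) (h1.trans h2.symm)
  simp only [ZMod.coe_unitOfCoprime] at h3
  exact (ZMod.natCast_eq_natCast_iff _ _ _).1 h3

theorem siegel_raw {α β : Type*} [Fintype α] [Fintype β] [DecidableEq β] (A : Matrix α β ℤ) (M : ℤ)
    (hM1 : 1 ≤ M) (hM : ∀ i j, |A i j| ≤ M) (h1 : 0 < Fintype.card α)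
    (h2 : 2 * Fintype.card α ≤ Fintype.card β) :
    ∃ t : β → ℤ, t ≠ 0 ∧ A.mulVec t = 0 ∧ ∀ j, |t j| ≤ Fintype.card β * M := by
  obtain ⟨t, ht0, hA, ht⟩ := Int.Matrix.exists_ne_zero_int_vec_norm_le A (by omega) h1
  refine ⟨t, ht0, hA, ?_⟩
  intro j
  letI := Matrix.seminormedAddCommGroup (m := α) (n := β) (α := ℤ)
  have hM1R : (1 : ℝ) ≤ M := by exact_mod_cast hM1
  have hAM : ‖A‖ ≤ (M : ℝ) := by
    rw [Matrix.norm_le_iff (by linarith)]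
    intro i j
    rw [Int.norm_eq_abs]
    exact_mod_cast hM i j
  have hb1 : (1 : ℝ) ≤ Fintype.card β := by exact_mod_cast (by omega : 1 ≤ Fintype.card β)
  have hab : (2 * Fintype.card α : ℝ) ≤ Fintype.card β := by exact_mod_cast h2
  have ha : (0 : ℝ) < Fintype.card α := by exact_mod_cast h1
  have h3 : ‖t j‖ ≤ (Fintype.card β : ℝ) * M := by
    calc ‖t j‖ ≤ ‖t‖ := norm_le_pi_norm t j
      _ ≤ _ := ht
      _ ≤ ((Fintype.card β : ℝ) * max 1 ‖A‖) ^ (1 : ℝ) := by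
          apply Real.rpow_le_rpow_of_exponent_le
          · exact one_le_mul_of_one_le_of_one_le hb1 (le_max_left _ _)
          · rw [div_le_one (by linarith)]; linarith
      _ ≤ _ := by
          rw [Real.rpow_one]
          gcongr
          exact max_le hM1R hAM
  rw [Int.norm_eq_abs] at h3
  exact_mod_cast h3

theorem siegel_start {n p ee d W Q T S : ℕ} (hp : p.Prime) (q : Fin n → ℕ) (b : Fin n → ℤ) (i0 : Fin n)
    (hq : ∀ i, (q i).Prime) (hqp : ∀ i, q i ≠ p) (hW : ∏ i, q i ≤ p ^ W)
    (hgam : ∀ v ∈ bbox n Q, ∀ j, |gam b i0 j v| ≤ (p : ℤ) ^ d) (hS : 1 ≤ S) (hQd : Q ≤ p ^ d)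
    (hN : Nat.totient (p ^ ee) * (2 * (S * (T + 1) ^ (n - 1))) ≤ Q ^ n) :
    ∃ c : (Fin n → ℕ) → ℤ,
      (∀ v ∈ bbox n Q, ∀ v' ∈ bbox n Q, c v ≠ 0 → c v' ≠ 0 → qpow q v ≡ qpow q v' [MOD p ^ ee]) ∧
      (∃ v ∈ bbox n Q, c v ≠ 0) ∧
      (∀ v ∈ bbox n Q, |c v| ≤ (p : ℤ) ^ (n * d + d * T + W * (Q * S))) ∧
      Van q b i0 Q c T (Finset.range S) := by
  classical
  obtain ⟨G, hGs, hGc, hG⟩ := siegel_class hp q hq hqp _ hN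
  have hp0 := hp.pos
  let A : Matrix (Fin S × ({j // j ≠ i0} → Fin (T + 1))) G ℤ := fun r v =>
    let m : Fin n → ℕ := fun j => if h : j ≠ i0 then (r.2 ⟨j, h⟩ : ℕ) else 0
    if ∑ j, m j ≤ T then mon b i0 m v * (qpow q v : ℤ) ^ (r.1 : ℕ) else 0
  have hcard : Fintype.card (Fin S × ({j // j ≠ i0} → Fin (T + 1))) = S * (T + 1) ^ (n - 1) := by
    simp [Fintype.card_subtype_compl]
  have hpZ : (1 : ℤ) ≤ p := by exact_mod_cast hp0
  obtain ⟨t, ht0, hA, ht⟩ := siegel_raw A ((p : ℤ) ^ (d * T + W * (Q * S))) (one_le_pow₀ hpZ) (by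
      intro r v
      simp only [A]
      split_ifs with h
      · rw [abs_mul, pow_add]
        have h1 := mon_abs_le hp0 b i0 hgam _ h v (hGs v.2)
        have h2 : |(qpow q v : ℤ) ^ (r.1 : ℕ)| ≤ (p : ℤ) ^ (W * (Q * S)) := by
          have h3 := prod_q_pow_le q (fun i => (hq i).pos) hW (fun i => (v : Fin n → ℕ) i * r.1) (Q * S) (by
            intro i
            exact Nat.mul_le_mul (mem_bbox.1 (hGs v.2) i).le r.1.2.le)
          rw [abs_of_nonneg (by positivity)]
          refine le_trans (le_of_eq ?_) h3
          rw [qpow]; push_cast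
          rw [← Finset.prod_pow]
          simp [pow_mul]
        gcongr
      · simp) (by
      rw [hcard]; positivity) (by rw [hcard, Fintype.card_coe]; exact hGc)
  let c : (Fin n → ℕ) → ℤ := fun v => if h : v ∈ G then t ⟨v, h⟩ else 0
  have hc : ∀ v, c v ≠ 0 → v ∈ G := by
    intro v hv; by_contra h; exact hv (by simp [c, h])
  refine ⟨c, ?_, ?_, ?_, ?_⟩
  · intro v _ v' _ h1 h2
    exact hG v (hc v h1) v' (hc v' h2)
  · obtain ⟨v, hv⟩ := Function.ne_iff.1 ht0
    exact ⟨v, hGs v.2, by simpa [c] using hv⟩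
  · intro v hv
    by_cases h : v ∈ G
    · have h1 := ht ⟨v, h⟩
      have h2 : (Fintype.card G : ℤ) ≤ (p : ℤ) ^ (n * d) := by
        rw [Fintype.card_coe]
        have := Finset.card_le_card hGs
        rw [card_bbox] at this
        have h4 := this.trans (Nat.pow_le_pow_left hQd n)
        rw [← pow_mul, mul_comm d n] at h4
        exact_mod_cast h4
      simp only [c, h, dif_pos]
      refine h1.trans ?_
      rw [add_assoc, pow_add _ (n * d)]
      gcongr
    · simp only [c, h, dif_neg, not_false_eq_true, abs_zero]; positivity
  · intro s hs m hm
    rw [Finset.mem_range] at hs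
    have hsum : ∑ v ∈ bbox n Q, c v * mon b i0 m v * (qpow q v : ℤ) ^ s =
        ∑ v : G, t v * mon b i0 m v * (qpow q v : ℤ) ^ s := by
      rw [← Finset.sum_subset hGs (by intro v _ hv; simp [c, hv]), ← Finset.sum_attach]
      simp [c]
    rw [hsum]
    by_cases hm0 : m i0 = 0
    · have hle : ∀ j, m j < T + 1 := fun j =>
        Nat.lt_succ_of_le ((Finset.single_le_sum (fun _ _ => Nat.zero_le _) (Finset.mem_univ j)).trans hm)
      have h1 := congrFun hA (⟨s, hs⟩, fun j => ⟨m j, hle j⟩)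
      have hmm : (fun j => if h : j ≠ i0 then ((⟨m j, hle j⟩ : Fin (T + 1)) : ℕ) else 0) = m := by
        funext j
        by_cases h : j = i0
        · simp [h, hm0]
        · simp [h]
      simp only [A, Matrix.mulVec, dotProduct, Pi.zero_apply] at h1
      rw [hmm] at h1
      simp only [hm, if_true] at h1
      rw [← h1]
      apply Finset.sum_congr rfl
      intro v _; ring
    · apply Finset.sum_eq_zero
      intro v _
      have : mon b i0 m v = 0 := by
        rw [mon]
        apply Finset.prod_eq_zero (Finset.mem_univ i0)
        rw [gam_self, zero_pow hm0]
      rw [this]; ring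

end

section

theorem baker_core {n p ee V l d W : ℕ} {q : Fin n → ℕ} {b : Fin n → ℤ} {i0 : Fin n}
    (X : Ctx n p ee V l d W q b i0) (J0 S0 k y Q : ℕ) (hQ : Q = l ^ J0) (hW1 : 1 ≤ W)
    (hlS : l ∣ S0) (hS1 : 2 * d * (n + 96 * (k + 1)) ≤ S0) (hS0 : 1 < S0)
    (hgam : ∀ v ∈ bbox n Q, ∀ j, |gam b i0 j v| ≤ (p : ℤ) ^ d) (hQd : Q ≤ p ^ d) (hld : l ≤ p ^ d)
    (hN : Nat.totient (p ^ ee) * (2 * (S0 * (96 * (k + 1) * W * Q + 1) ^ (n - 1))) ≤ Q ^ n)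
    (hlk : l ^ n ≤ 2 ^ k) (hy : 24 * W * S0 * Q * 2 ^ k ≤ p ^ y)
    (hV : ee + 48 * W * Q * (d + 2 * S0 * 2 ^ k * (y + 1)) ≤ V) : False := by
  have hl2 := X.hl.two_le
  have hp0 := X.hp.pos
  have hpZ : (1 : ℤ) ≤ p := by exact_mod_cast hp0
  have hn : 1 ≤ n := by have := i0.2; omega
  have hd1 : 1 ≤ d := by
    by_contra h
    have : d = 0 := by omega
    subst this; simp at hld; omega
  have hQ1 : 1 ≤ Q := by rw [hQ]; exact Nat.one_le_pow _ _ (by omega)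
  set T0 := 96 * (k + 1) * W with hT0
  set h := n * d + d * (T0 * Q) + W * (Q * S0) with hh
  have key : ∀ J ≤ J0, ∃ c : (Fin n → ℕ) → ℤ,
      (∀ v ∈ bbox n (l ^ (J0 - J)), ∀ v' ∈ bbox n (l ^ (J0 - J)), c v ≠ 0 → c v' ≠ 0 →
        qpow q v ≡ qpow q v' [MOD p ^ ee]) ∧
      (∃ v ∈ bbox n (l ^ (J0 - J)), c v ≠ 0) ∧
      (∀ v ∈ bbox n (l ^ (J0 - J)), |c v| ≤ (p : ℤ) ^ h) ∧
      Van q b i0 (l ^ (J0 - J)) c (T0 * l ^ (J0 - J))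
        ((Finset.range (S0 * l ^ J)).filter (fun s => ¬ l ∣ s)) := by
    intro J
    induction J with
    | zero =>
      intro _
      obtain ⟨c, h1, h2, h3, h4⟩ := siegel_start (ee := ee) (T := T0 * Q) X.hp q b i0 X.hq X.hqp X.hW hgam
        (by omega) hQd hN
      simp only [Nat.sub_zero, ← hQ]
      refine ⟨c, h1, h2, h3, ?_⟩
      intro s hs
      exact h4 s (by simpa using (Finset.mem_filter.1 hs).1)
    | succ J ih =>
      intro hJ
      obtain ⟨c, h1, h2, h3, h4⟩ := ih (by omega)
      obtain ⟨r, hr⟩ : ∃ r, J0 = J + 1 + r := ⟨J0 - (J + 1), by omega⟩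
      have e1 : J0 - J = r + 1 := by omega
      have e2 : J0 - (J + 1) = r := by omega
      rw [e1, pow_succ', ] at h1 h2 h3 h4
      rw [e2]
      have hL1 : 1 ≤ l ^ r := Nat.one_le_pow _ _ (by omega)
      have hJ1 : 1 ≤ l ^ J := Nat.one_le_pow _ _ (by omega)
      have hLQ : (l * l ^ r) * l ^ J = Q := by rw [hQ, hr]; ring
      set L' := l ^ r with hL'
      set M := l ^ J with hM
      have hle : l * L' ≤ Q := by rw [← hLQ]; exact Nat.le_mul_of_pos_right _ hJ1
      have hMle : M ≤ Q := by
        rw [← hLQ]; exact Nat.le_mul_of_pos_left _ (by positivity)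
      have hsub : ∀ v ∈ bbox n (l * L'), v ∈ bbox n Q := fun v hv =>
        mem_bbox.2 fun i => (mem_bbox.1 hv i).trans_le hle
      have hST : (l * L') * (S0 * M) = S0 * Q := by rw [← hLQ]; ring
      obtain ⟨c', g1, g2, g3, g4⟩ := stage X L' c h1 h2 ((p : ℤ) ^ h) (by positivity) h3 (n * d + h)
        (by
          rw [pow_add _ (n * d) h]
          gcongr
          have : (l * L') ^ n ≤ p ^ (n * d) := by
            calc (l * L') ^ n ≤ (p ^ d) ^ n := Nat.pow_le_pow_left (hle.trans hQd) _
              _ = _ := by rw [← pow_mul, mul_comm]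
          exact_mod_cast this)
        (fun v hv j => hgam v (hsub v hv) j) (T0 * (l * L')) (T0 * L') (S0 * M) y k h4
        (hlS.mul_right _) (Nat.mul_pos (by omega) hJ1) hL1 hW1 hlk hld
        (by
          have e : 4 * W * (l * L') * (S0 * M) = 4 * W * (S0 * Q) := by rw [← hST]; ring
          rw [e]
          have i1 : d * (T0 * (l * L')) ≤ d * (T0 * Q) := by gcongr
          have i2 : n * d < W * Q * (2 * d * n) := by
            have : 1 ≤ W * Q := Nat.mul_pos hW1 hQ1
            have h5 : 1 ≤ n * d := Nat.mul_pos hn hd1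
            nlinarith
          have i3 : W * Q * (2 * d * (n + 96 * (k + 1))) ≤ W * Q * S0 := by gcongr
          have i4 : W * Q * (2 * d * (n + 96 * (k + 1))) = W * Q * (2 * d * n) + 2 * (d * (T0 * Q)) := by
            rw [hT0]; ring
          have i5 : W * (Q * S0) = W * Q * S0 := by ring
          have i6 : 4 * W * (S0 * Q) = 4 * (W * Q * S0) := by ring
          rw [hh]
          omega)
        (by
          rw [hT0]
          have : 2 * L' ≤ l * L' := by gcongr
          have e3 : 96 * (k + 1) * W * L' + 8 * (6 * W * (l * L')) * (k + 1) =
            48 * (k + 1) * W * (2 * L' + l * L') := by ring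
          have e4 : 96 * (k + 1) * W * (l * L') = 48 * (k + 1) * W * (l * L' + l * L') := by ring
          rw [e3, e4]; gcongr)
        (by
          refine le_trans ?_ hV
          have e3 : 8 * (6 * W * (l * L')) * (d + 2 * (S0 * M * 2 ^ k) * (y + 1)) =
            48 * W * (l * L') * d + 48 * W * ((l * L') * (S0 * M)) * (2 * 2 ^ k * (y + 1)) := by ring
          have e4 : 48 * W * Q * (d + 2 * S0 * 2 ^ k * (y + 1)) =
            48 * W * Q * d + 48 * W * (S0 * Q) * (2 * 2 ^ k * (y + 1)) := by ring
          rw [e3, e4, hST]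
          gcongr)
        (by
          refine le_trans ?_ hy
          calc S0 * M * 2 ^ k ≤ 1 * 1 * S0 * Q * 2 ^ k := by rw [one_mul, one_mul]; gcongr
            _ ≤ _ := by gcongr; norm_num)
        (by
          refine le_trans ?_ hy
          calc 4 * (6 * W * (l * L')) = 24 * W * 1 * (l * L') * 1 := by ring
            _ ≤ _ := by gcongr; exact Nat.one_le_two_pow)
      refine ⟨c', g1, g2, g3, ?_⟩
      have : S0 * l ^ (J + 1) = l * (S0 * M) := by rw [pow_succ]; ring
      rw [this]; exact g4
  obtain ⟨c, -, ⟨v, hv, hcv⟩, -, hvan⟩ := key J0 le_rfl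
  rw [Nat.sub_self, pow_zero] at hv hvan
  have hbb : bbox n 1 = {0} := by
    ext w; rw [mem_bbox, Finset.mem_singleton]
    constructor
    · intro h; funext i; simpa using h i
    · rintro rfl i; simp
  have h1 := hvan 1 (by
    rw [Finset.mem_filter, Finset.mem_range]
    refine ⟨?_, fun h => ?_⟩
    · exact lt_of_lt_of_le hS0 (Nat.le_mul_of_pos_right _ (Nat.one_le_pow _ _ (by omega)))
    · have := Nat.le_of_dvd one_pos h; omega) 0 (by simp)
  rw [hbb] at h1 hv
  rw [Finset.mem_singleton] at hv
  subst hv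
  simp [mon, qpow] at h1
  exact hcv h1

end

section

theorem theta_lower (n : ℕ) (hn : 10 ^ 8 ≤ n) : (n : ℝ) / 2 ≤ Chebyshev.theta n := by
  have h := Chebyshev.theta_ge n
  have hn' : (10 : ℝ) ^ 8 ≤ n := by exact_mod_cast hn
  have hn0 : (0 : ℝ) < n := by linarith [show (0 : ℝ) < 10 ^ 8 by norm_num]
  set u : ℝ := (n : ℝ) ^ (1 / 4 : ℝ) with hu
  have hu4 : u ^ 4 = n := by
    rw [hu, ← Real.rpow_natCast, ← Real.rpow_mul hn0.le]; norm_num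
  have hu2 : u ^ 2 = √n := by
    rw [← hu4, show u ^ 4 = (u ^ 2) ^ 2 by ring, Real.sqrt_sq (by positivity)]
  have hu0 : 0 ≤ u := by positivity
  have hu100 : 100 ≤ u := by
    by_contra hc
    have : u ^ 4 < 100 ^ 4 := pow_lt_pow_left₀ (not_le.1 hc) hu0 (by norm_num)
    rw [hu4] at this
    norm_num at this hn'; linarith
  have hlog : Real.log n ≤ 4 * u := by
    have := Real.log_le_rpow_div hn0.le (show (0 : ℝ) < 1 / 4 by norm_num)
    rw [← hu] at this; linarith
  have hlog1 : Real.log (n + 1) ≤ 4 * u + 1 := by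
    have h1 : Real.log ((n : ℝ) + 1) ≤ Real.log (2 * n) := Real.log_le_log (by linarith) (by
      have : (1 : ℝ) ≤ 10 ^ 8 := by norm_num
      linarith)
    rw [Real.log_mul (by norm_num) hn0.ne'] at h1
    linarith [Real.log_two_lt_d9]
  have hl2 := Real.log_two_gt_d9
  have e1 : 2 * √(n : ℝ) * Real.log n ≤ 8 * u ^ 3 := by
    rw [← hu2]
    have : 2 * u ^ 2 * Real.log n ≤ 2 * u ^ 2 * (4 * u) := by gcongr
    linarith [this, show 2 * u ^ 2 * (4 * u) = 8 * u ^ 3 by ring]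
  have e2 : (n : ℝ) * 0.69 ≤ n * Real.log 2 := by gcongr; linarith
  have e3 : 100 * u ^ 3 ≤ u ^ 4 := by
    rw [show u ^ 4 = u * u ^ 3 by ring]; gcongr
  have e4 : 10000 * u ≤ u ^ 3 := by
    rw [show u ^ 3 = u ^ 2 * u by ring]; gcongr; nlinarith
  rw [hu4] at e3
  linarith

theorem exists_ell (p : ℕ) (hp : p.Prime) :
    ∃ l : ℕ, l.Prime ∧ ¬ l ∣ p * (p - 1) ∧ (l : ℝ) ≤ 10 ^ 9 * Real.log p := by
  have hp2 : (2 : ℝ) ≤ p := by exact_mod_cast hp.two_le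
  have hlp : 0.69 ≤ Real.log p := by
    have := Real.log_le_log (by norm_num) hp2
    linarith [Real.log_two_gt_d9]
  set N := ⌊4 * Real.log p⌋₊ + 1 + 10 ^ 8 with hN
  by_contra hcon
  push Not at hcon
  have hNle : (N : ℝ) ≤ 10 ^ 9 * Real.log p := by
    have := Nat.floor_le (show 0 ≤ 4 * Real.log p by linarith)
    rw [hN]; push_cast
    norm_num; linarith
  have hdvd : primorial N ∣ p * (p - 1) := by
    rw [primorial]
    apply Finset.prod_primes_dvd
    · intro l hl; exact (Finset.mem_filter.1 hl).2.prime
    · intro l hl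
      rw [Finset.mem_filter, Finset.mem_range] at hl
      by_contra hnd
      have h1 := hcon l hl.2 hnd
      have h2 : (l : ℝ) ≤ N := by exact_mod_cast Nat.lt_succ_iff.1 hl.1
      linarith
  have hle : primorial N ≤ p ^ 2 := by
    have h1 := Nat.le_of_dvd (Nat.mul_pos hp.pos (by have := hp.two_le; omega)) hdvd
    refine h1.trans ?_
    rw [pow_two]; exact Nat.mul_le_mul_left _ (Nat.sub_le _ _)
  have hth := theta_lower N (by omega)
  rw [Chebyshev.theta_eq_log_primorial, Nat.floor_natCast] at hth
  have h3 : Real.log (primorial N) ≤ Real.log ((p : ℝ) ^ 2) :=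
    Real.log_le_log (by exact_mod_cast primorial_pos N) (by exact_mod_cast hle)
  rw [Real.log_pow] at h3
  have h4 := Nat.lt_floor_add_one (4 * Real.log p)
  have h5 : (⌊4 * Real.log p⌋₊ : ℝ) + 1 ≤ N := by rw [hN]; push_cast; linarith [show (0:ℝ) ≤ 10 ^ 8 by norm_num]
  push_cast at h3
  linarith

theorem exists_ee (p : ℕ) (hp : p.Prime) : ∃ ee, ee ≠ 0 ∧ ee ≤ 2 ∧ ee + 2 ≤ p * ee ∧
    (∀ k, 2 * padicValNat p k.factorial + k ≤ 2 * ee * k) ∧ Nat.totient (p ^ ee) ≤ p := by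
  have hf : Fact p.Prime := ⟨hp⟩
  rcases hp.eq_two_or_odd with h | h
  · subst h
    refine ⟨2, by norm_num, by norm_num, by norm_num, ?_, by decide⟩
    intro k
    have := sub_one_mul_padicValNat_factorial (p := 2) k
    have := Nat.sub_le k (Nat.digits 2 k).sum
    omega
  · have h2 := hp.two_le
    have h3 : 3 ≤ p := by omega
    refine ⟨1, by norm_num, by norm_num, by omega, ?_, ?_⟩
    · intro k
      have h4 := sub_one_mul_padicValNat_factorial (p := p) k
      have h5 := Nat.sub_le k (Nat.digits p k).sum
      have h6 : 2 * padicValNat p k.factorial ≤ (p - 1) * padicValNat p k.factorial := by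
        gcongr; omega
      omega
    · rw [pow_one]; exact Nat.totient_le p

end

section

theorem two_pow_clog_le (l : ℕ) (hl : 2 ≤ l) : 2 ^ Nat.clog 2 l ≤ 2 * l := by
  have h1 := Nat.pow_pred_clog_lt_self (b := 2) (by norm_num) (x := l) (by omega)
  have h2 : 0 < Nat.clog 2 l := Nat.clog_pos (by norm_num) (by omega)
  obtain ⟨m, hm⟩ : ∃ m, Nat.clog 2 l = m + 1 := ⟨Nat.clog 2 l - 1, by omega⟩
  rw [hm] at h1 ⊢
  simp only [Nat.pred_eq_sub_one, Nat.add_sub_cancel] at h1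
  rw [pow_succ]; omega

theorem baker_nat {n p V l W B : ℕ} {q : Fin n → ℕ} {b : Fin n → ℤ} {i0 : Fin n}
    (hp : p.Prime) (hq : ∀ i, (q i).Prime) (hqp : ∀ i, q i ≠ p) (hinj : Function.Injective q)
    (hb0 : b i0 ≠ 0) (hb : ∏ i, q i ^ (b i).toNat ≡ ∏ i, q i ^ (-b i).toNat [MOD p ^ V])
    (hl : l.Prime) (hlp : ¬ l ∣ p * (p - 1)) (hW : ∏ i, q i ≤ p ^ W) (hW1 : 1 ≤ W)
    (hB : ∀ i, |b i| ≤ B) (k κ Θ : ℕ) (hk : k = n * Nat.clog 2 l) (hκ : κ = n + 96 * (k + 1))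
    (hΘ : Θ = 384 * (k + 1) * W * l) :
    ∃ d y, d ≤ 2 * Nat.clog 2 (16 * B * p * l ^ 2 * κ * Θ ^ n) ∧
      y ≤ Nat.clog 2 (192 * p * d ^ 2 * l ^ 3 * κ ^ 2 * Θ ^ n) ∧
      V ≤ 1168 * p * l ^ 3 * d ^ 2 * κ ^ 2 * (y + 1) * Θ ^ n := by
  obtain ⟨ee, hee0, hee2, hpm, hpe, hφ⟩ := exists_ee p hp
  have hp2 := hp.two_le
  have hl2 := hl.two_le
  have hn : 1 ≤ n := by have := i0.2; omega
  set φ := Nat.totient (p ^ ee) with hφd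
  have hφ0 : 1 ≤ φ := Nat.totient_pos.2 (by positivity)
  have hB1 : 1 ≤ B := by
    have := hB i0
    have h2 : 0 < |b i0| := abs_pos.2 hb0
    by_contra h
    have : B = 0 := by omega
    subst this; simp at *; omega
  set A := 192 * (k + 1) * W with hA
  have hA1 : 1 ≤ A := Nat.mul_pos (by omega) hW1
  have hκ1 : 1 ≤ κ := by omega
  set Z := 4 * φ * l * κ * A ^ (n - 1) with hZ
  have hAn : 1 ≤ A ^ (n - 1) := Nat.one_le_pow _ _ hA1
  have hZφ : φ ≤ Z := by
    calc φ = 1 * φ * 1 * 1 * 1 := by ring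
      _ ≤ 4 * φ * l * κ * A ^ (n - 1) := by gcongr <;> omega
  have hl1 : 1 ≤ l := by omega
  have hp1 : 1 < p := by omega
  set Y := 4 * B * l * Z with hY
  have hZ1 : 1 ≤ Z := hφ0.trans hZφ
  have hBlZ : 1 ≤ B * l * Z := Nat.mul_pos (Nat.mul_pos hB1 hl1) hZ1
  have hY4 : Y = 4 * (B * l * Z) := by rw [hY]; ring
  set c := Nat.clog p Y with hc
  have hc1 : 1 ≤ c := Nat.clog_pos hp1 (by omega)
  have hpc : Y ≤ p ^ c := Nat.le_pow_clog hp1 Y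
  have hpc2 : c ≤ p ^ c := (Nat.lt_pow_self hp1).le
  set d := 2 * c with hd
  have hpd : 2 * B * l * Z * d ≤ p ^ d := by
    calc 2 * B * l * Z * d = Y * c := by rw [hY, hd]; ring
      _ ≤ p ^ c * p ^ c := Nat.mul_le_mul hpc hpc2
      _ = p ^ d := by rw [hd, ← pow_add]; congr 1; ring
  set J0 := Nat.clog l (Z * d) with hJ0
  set Q := l ^ J0 with hQ
  have hd1 : 1 ≤ d := by omega
  have hQ1 : Z * d ≤ Q := Nat.le_pow_clog (by omega) _
  have hZd : 1 < Z * d := by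
    calc 1 < 1 * 2 := by norm_num
      _ ≤ Z * d := Nat.mul_le_mul hZ1 (by omega)
  have hQ2 : Q ≤ l * (Z * d) := by
    have h1 := Nat.pow_pred_clog_lt_self (b := l) (by omega) hZd
    have h2 : 0 < J0 := Nat.clog_pos (by omega) hZd
    rw [← hJ0] at h1
    rw [hQ, show J0 = J0.pred + 1 by simp [Nat.pred_eq_sub_one]; omega, pow_succ']
    exact Nat.mul_le_mul_left _ h1.le
  have hQpos : 1 ≤ Q := by omega
  have hQd2 : 2 * B * Q ≤ p ^ d := by
    refine le_trans ?_ hpd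
    calc 2 * B * Q ≤ 2 * B * (l * (Z * d)) := by gcongr
      _ = _ := by ring
  have hQd : Q ≤ p ^ d := le_trans (by
    calc Q = 1 * 1 * Q := by ring
      _ ≤ 2 * B * Q := by gcongr; norm_num) hQd2
  have hld : l ≤ p ^ d := le_trans (by
    calc l = 1 * 1 * l * 1 * 1 := by ring
      _ ≤ 2 * B * l * Z * d := by gcongr; norm_num) hpd
  have hφd' : B * φ ≤ p ^ d := le_trans (by
    calc B * φ = 1 * B * 1 * φ * 1 := by ring
      _ ≤ 2 * B * l * Z * d := by gcongr; norm_num) hpd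
  set S0 := 2 * l * d * κ with hS0
  set y := Nat.clog p (24 * W * S0 * Q * 2 ^ k) with hy
  have hlk : l ^ n ≤ 2 ^ k := by
    rw [hk, mul_comm, pow_mul]
    exact Nat.pow_le_pow_left (Nat.le_pow_clog (by norm_num) _) _
  have hkl : 2 ^ k ≤ (2 * l) ^ n := by
    rw [hk, mul_comm, pow_mul]
    exact Nat.pow_le_pow_left (two_pow_clog_le l hl2) _
  have hΘA : Θ = A * (2 * l) := by rw [hΘ, hA]; ring
  have hΘ1 : W * A ^ (n - 1) * (2 * l) ^ n ≤ Θ ^ n := by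
    rw [hΘA, mul_pow A (2 * l) n]
    have : A ^ n = A * A ^ (n - 1) := by
      rw [← pow_succ']; congr 1; omega
    rw [this]
    gcongr
    rw [hA]; exact Nat.le_mul_of_pos_left _ (by omega)
  have hΘ2 : A ^ (n - 1) ≤ Θ ^ n := by
    refine le_trans ?_ hΘ1
    calc A ^ (n - 1) = 1 * A ^ (n - 1) * 1 := by ring
      _ ≤ _ := by gcongr; exact Nat.one_le_pow _ _ (by omega)
  have hmain : W * Q * S0 * 2 ^ k ≤ 8 * p * l ^ 3 * κ ^ 2 * d ^ 2 * Θ ^ n := by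
    calc W * Q * S0 * 2 ^ k ≤ W * (l * (Z * d)) * S0 * (2 * l) ^ n := by gcongr
      _ = 8 * φ * l ^ 3 * κ ^ 2 * d ^ 2 * (W * A ^ (n - 1) * (2 * l) ^ n) := by
          rw [hZ, hS0]; ring
      _ ≤ _ := by gcongr
  have hS0d : d ≤ S0 := by
    calc d = 1 * 1 * d * 1 := by ring
      _ ≤ 2 * l * d * κ := by gcongr; norm_num
  refine ⟨d, y, ?_, ?_, ?_⟩
  · rw [hd]
    apply Nat.mul_le_mul_left
    refine Nat.clog_mono (by norm_num) hp2 ?_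
    calc Y = 16 * B * φ * l ^ 2 * κ * A ^ (n - 1) := by rw [hY, hZ]; ring
      _ ≤ _ := by gcongr
  · refine Nat.clog_mono (by norm_num) hp2 ?_
    calc 24 * W * S0 * Q * 2 ^ k = 24 * (W * Q * S0 * 2 ^ k) := by ring
      _ ≤ 24 * (8 * p * l ^ 3 * κ ^ 2 * d ^ 2 * Θ ^ n) := by gcongr
      _ = _ := by ring
  · by_contra hV
    push Not at hV
    refine baker_core (V := V) (l := l) (d := d) (W := W) (q := q) (b := b) (i0 := i0) (ee := ee)
      ⟨hp, hee0, hpm, hpe, hq, hqp, hinj, hb0, hb, ?_, hl, hlp, hW⟩ J0 S0 k y Q hQ hW1 ?_ ?_ ?_ ?_ hQd hld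
      ?_ hlk ?_ ?_
    · rw [abs_mul]
      calc |b i0| * |(φ : ℤ)| ≤ B * φ := by
            rw [abs_of_nonneg (show (0 : ℤ) ≤ φ by positivity)]; gcongr; exact hB i0
        _ ≤ _ := by exact_mod_cast hφd'
    · exact ⟨2 * d * κ, by rw [hS0]; ring⟩
    · rw [← hκ, hS0]
      calc 2 * d * κ = 2 * 1 * d * κ := by ring
        _ ≤ _ := by gcongr
    · omega
    · intro v hv j
      rw [mem_bbox] at hv
      have h1 : |gam b i0 j v| ≤ |b i0 * v j| + |b j * v i0| := by rw [gam]; exact abs_sub _ _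
      rw [abs_mul, abs_mul, Nat.abs_cast, Nat.abs_cast] at h1
      have h2 : |b i0| * (v j : ℤ) ≤ B * Q := by
        gcongr
        · exact hB i0
        · exact_mod_cast (hv j).le
      have h3 : |b j| * (v i0 : ℤ) ≤ B * Q := by
        gcongr
        · exact hB j
        · exact_mod_cast (hv i0).le
      have h4 : ((2 * B * Q : ℕ) : ℤ) ≤ ((p ^ d : ℕ) : ℤ) := by exact_mod_cast hQd2
      push_cast at h4
      linarith
    · have e1 : 96 * (k + 1) * W * Q + 1 ≤ A * Q := by
        have : 1 ≤ (k + 1) * W * Q := Nat.mul_pos (Nat.mul_pos (by omega) hW1) hQpos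
        have e2 : A * Q = 192 * ((k + 1) * W * Q) := by rw [hA]; ring
        have e3 : 96 * (k + 1) * W * Q = 96 * ((k + 1) * W * Q) := by ring
        omega
      calc φ * (2 * (S0 * (96 * (k + 1) * W * Q + 1) ^ (n - 1))) ≤ φ * (2 * (S0 * (A * Q) ^ (n - 1))) := by
            gcongr
        _ = Z * d * Q ^ (n - 1) := by rw [hZ, hS0, mul_pow]; ring
        _ ≤ Q * Q ^ (n - 1) := by gcongr
        _ = Q ^ n := by rw [← pow_succ']; congr 1; omega
    · exact Nat.le_pow_clog hp1 _
    · refine le_trans ?_ hV.le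
      have h2k : 1 ≤ 2 ^ k := Nat.one_le_two_pow
      have hS01 : 1 ≤ S0 := hd1.trans hS0d
      set P := W * Q * S0 * 2 ^ k * (y + 1) with hP
      have i1 : 1 ≤ P := by
        rw [hP]
        exact Nat.mul_pos (Nat.mul_pos (Nat.mul_pos (Nat.mul_pos hW1 hQpos) hS01) h2k) (by omega)
      have i2 : W * Q * d ≤ P := by
        calc W * Q * d = W * Q * d * 1 * 1 := by ring
          _ ≤ _ := by rw [hP]; gcongr; omega
      calc ee + 48 * W * Q * (d + 2 * S0 * 2 ^ k * (y + 1)) = ee + 48 * (W * Q * d) + 96 * P := by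
            rw [hP]; ring
        _ ≤ 146 * P := by omega
        _ = 146 * (W * Q * S0 * 2 ^ k) * (y + 1) := by rw [hP]; ring
        _ ≤ 146 * (8 * p * l ^ 3 * κ ^ 2 * d ^ 2 * Θ ^ n) * (y + 1) := by gcongr
        _ = _ := by ring

end

section

theorem clog_le_rpow (θ : ℝ) (hθ : 0 < θ) (hθ1 : θ ≤ 1) : ∃ C : ℝ, 1 ≤ C ∧ ∀ m : ℕ, (Nat.clog 2 m : ℝ) ≤ C * (m : ℝ) ^ θ := by
  refine ⟨max 1 (4 / θ), le_max_left _ _, ?_⟩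
  intro m
  rcases Nat.lt_or_ge m 2 with h | h
  · rw [Nat.clog_of_right_le_one (by omega)]
    simp only [Nat.cast_zero]; positivity
  have h1 := two_pow_clog_le m h
  have h2 : (2 : ℝ) ^ Nat.clog 2 m ≤ 2 * m := by exact_mod_cast h1
  have hm : (0 : ℝ) < m := by positivity
  have h3 := Real.log_le_log (by positivity) h2
  rw [Real.log_pow] at h3
  have h4 := Real.log_le_rpow_div (show (0 : ℝ) ≤ 2 * m by positivity) hθ
  rw [Real.mul_rpow (by norm_num) hm.le] at h4
  have h5 : (2 : ℝ) ^ θ ≤ 2 := by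
    calc (2 : ℝ) ^ θ ≤ 2 ^ (1 : ℝ) := Real.rpow_le_rpow_of_exponent_le (by norm_num) hθ1
      _ = 2 := Real.rpow_one _
  have h6 : (2 : ℝ) ^ θ * (m : ℝ) ^ θ / θ ≤ 2 * (m : ℝ) ^ θ / θ := by gcongr
  have h7 : (Nat.clog 2 m : ℝ) * (1 / 2) ≤ Nat.clog 2 m * Real.log 2 := by
    gcongr; linarith [Real.log_two_gt_d9]
  have h8 : (Nat.clog 2 m : ℝ) ≤ 4 / θ * (m : ℝ) ^ θ := by
    have : 4 / θ * (m : ℝ) ^ θ = 2 * (2 * (m : ℝ) ^ θ / θ) := by ring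
    rw [this]; linarith
  refine h8.trans ?_
  gcongr
  exact le_max_right _ _

theorem nu_le (c θ : ℝ) (hc : 0 ≤ c) (hθ : 0 < θ) : ∃ C : ℝ, 0 ≤ C ∧ ∀ (ν : ℕ) (L : ℝ), 1 ≤ ν → 0 ≤ L →
    ν * Real.log ν - ν ≤ L → c * ν ≤ θ * L + C := by
  refine ⟨c * Real.exp (1 + c / θ), by positivity, ?_⟩
  intro ν L hν hL h
  have hν' : (1 : ℝ) ≤ ν := by exact_mod_cast hν
  rcases le_or_gt (Real.log ν) (1 + c / θ) with h1 | h1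
  · have h2 : (ν : ℝ) ≤ Real.exp (1 + c / θ) := by
      rw [← Real.exp_log (show (0 : ℝ) < ν by linarith)]
      exact Real.exp_le_exp.2 h1
    have : c * ν ≤ c * Real.exp (1 + c / θ) := by gcongr
    have : 0 ≤ θ * L := by positivity
    linarith
  · have h2 : (ν : ℝ) * (c / θ) ≤ L := by
      have : (ν : ℝ) * (1 + c / θ) ≤ ν * Real.log ν := by gcongr
      linarith
    have h3 : c * ν ≤ θ * L := by
      have : c * ν = θ * (ν * (c / θ)) := by field_simp
      rw [this]; gcongr
    have : 0 ≤ c * Real.exp (1 + c / θ) := by positivity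
    linarith

theorem asym_P1 (θ A : ℝ) (hθ : 0 < θ) (hθ1 : θ ≤ 1) (hA : 1 ≤ A) : ∃ K : ℝ, 1 ≤ K ∧
    ∀ (ν : ℕ) (L : ℝ), 1 ≤ ν → 1 ≤ L → ν * Real.log ν - ν ≤ L →
      (A * L ^ (1 + θ)) ^ ν ≤ K * (ν : ℝ) ^ ν * Real.exp (θ * L) ^ 4 := by
  set c1 := Real.log A + 2 * (-Real.log θ) + θ with hc1
  have hc1p : 0 ≤ c1 := by
    have := Real.log_nonneg hA
    have := Real.log_nonpos hθ.le hθ1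
    linarith
  obtain ⟨C, hC, hnu⟩ := nu_le c1 θ hc1p hθ
  refine ⟨Real.exp C, by simpa using hC, ?_⟩
  intro ν L hν hL h
  have hν' : (1 : ℝ) ≤ ν := by exact_mod_cast hν
  have hn := hnu ν L hν (by linarith) h
  have hL0 : 0 < L := by linarith
  have hν0 : (0 : ℝ) < ν := by linarith
  rw [← Real.log_le_log_iff (by positivity) (by positivity), Real.log_pow, Real.log_mul (by positivity) (by positivity),
    Real.log_mul (by positivity) (by positivity), Real.log_mul (by positivity) (by positivity),
    Real.log_exp, Real.log_pow, Real.log_pow, Real.log_exp, Real.log_rpow hL0]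
  have hlog : Real.log L ≤ θ * (L / ν) - Real.log θ + Real.log ν := by
    have h1 := Real.log_le_sub_one_of_pos (show 0 < θ * (L / ν) by positivity)
    rw [Real.log_mul hθ.ne' (by positivity), Real.log_div hL0.ne' hν0.ne'] at h1
    linarith
  have h2 : (ν : ℝ) * ((1 + θ) * Real.log L) ≤ ν * ((1 + θ) * (θ * (L / ν) - Real.log θ + Real.log ν)) := by
    gcongr
  have h3 : (ν : ℝ) * ((1 + θ) * (θ * (L / ν) - Real.log θ + Real.log ν)) =
      (1 + θ) * θ * L + (1 + θ) * ν * (- Real.log θ) + ν * Real.log ν + θ * (ν * Real.log ν) := by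
    field_simp; ring
  have h4 : (1 + θ) * ν * (- Real.log θ) ≤ 2 * ν * (- Real.log θ) := by
    have := Real.log_nonpos hθ.le hθ1
    have h0 : 0 ≤ - Real.log θ := by linarith
    gcongr; linarith
  have h5 : θ * (ν * Real.log ν) ≤ θ * (L + ν) := by gcongr; linarith
  have h6 : (1 + θ) * θ * L ≤ 2 * θ * L := by gcongr; linarith
  push_cast
  rw [mul_add]
  have h7 : c1 * ν = ν * Real.log A + 2 * ν * (- Real.log θ) + θ * ν := by rw [hc1]; ring
  nlinarith

end

section

set_option maxHeartbeats 2000000 in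
theorem asym (δ : ℝ) (hδ : 0 < δ) (hδ1 : δ ≤ 1) : ∃ K : ℝ, 1 ≤ K ∧
    ∀ (ν n p l W B d y k κ Θ : ℕ) (L : ℝ), ν = n + 1 → 1 ≤ n → 2 ≤ l → 1 ≤ B → 1 ≤ W → 1 ≤ L →
      ν * Real.log ν - ν ≤ L → (p : ℝ) ≤ Real.exp L → 1 ≤ p → (l : ℝ) ≤ 10 ^ 9 * L →
      (W * l : ℝ) ≤ 2 * 10 ^ 9 * L → k = n * Nat.clog 2 l → κ = n + 96 * (k + 1) →
      Θ = 384 * (k + 1) * W * l → d ≤ 2 * Nat.clog 2 (16 * B * p * l ^ 2 * κ * Θ ^ n) →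
      y ≤ Nat.clog 2 (192 * p * d ^ 2 * l ^ 3 * κ ^ 2 * Θ ^ n) →
      ((1168 * p * l ^ 3 * d ^ 2 * κ ^ 2 * (y + 1) * Θ ^ n : ℕ) : ℝ) ≤
        K * p * (ν : ℝ) ^ (2 * ν) * Real.exp (δ * L) * (B : ℝ) ^ δ := by
  set θ := δ / 40 with hθd
  have hθ : 0 < θ := by positivity
  have hθ40 : θ ≤ 1 / 40 := by rw [hθd]; linarith
  have hθ1 : θ ≤ 1 := by linarith
  obtain ⟨Cl, hCl, hclog⟩ := clog_le_rpow θ hθ hθ1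
  obtain ⟨K1, hK1, hP1⟩ := asym_P1 θ (768 * 10 ^ 18 * Cl) hθ hθ1 (by nlinarith)
  obtain ⟨Cn, hCn, hnu⟩ := nu_le 1 θ zero_le_one hθ
  obtain ⟨Cm, hCm, hnu2⟩ := nu_le 2 θ (by norm_num) hθ
  set C1 : ℝ := 10 ^ 9 / θ with hC1
  have hC1p : 0 < C1 := by positivity
  set C2 : ℝ := 193 * Real.exp Cn * C1 with hC2
  have hC2p : 0 < C2 := by positivity
  set K2 : ℝ := K1 * Real.exp Cm with hK2
  have hK2p : 0 < K2 := by positivity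
  -- d
  set D0 : ℝ := 16 * C1 ^ 2 * C2 * K2 with hD0
  set C3 : ℝ := 2 * Cl * D0 ^ θ with hC3
  have hC3p : 0 < C3 := by positivity
  set Y0 : ℝ := 192 * C3 ^ 2 * C1 ^ 3 * C2 ^ 2 * K2 with hY0
  set C4 : ℝ := Cl * Y0 ^ θ + 1 with hC4
  have hC4p : 0 < C4 := by positivity
  refine ⟨max 1 (1168 * C1 ^ 3 * C3 ^ 2 * C2 ^ 2 * C4 * K1), le_max_left _ _, ?_⟩
  intro ν n p l W B d y k κ Θ L hν hn hl hB hW hL hνL hpL hp hlL hWl hk hκ hΘ hd hy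
  have hL0 : 0 < L := by linarith
  set x := Real.exp (θ * L) with hx
  set X := Real.exp L with hX
  have hx1 : 1 ≤ x := by rw [hx]; exact Real.one_le_exp (by positivity)
  have hX1 : 1 ≤ X := by rw [hX]; exact Real.one_le_exp (by positivity)
  have hxX : x ^ 40 ≤ X := by
    rw [hx, hX, ← Real.exp_nat_mul]
    apply Real.exp_le_exp.2
    push_cast
    nlinarith
  have hXx : ∀ m : ℕ, (X ^ m) ^ θ = x ^ m := by
    intro m
    rw [hX, hx, ← Real.exp_nat_mul, ← Real.exp_nat_mul, ← Real.exp_mul]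
    congr 1; ring
  have hxm : ∀ m : ℕ, m ≤ 40 → x ^ m ≤ X := fun m hm => (pow_le_pow_right₀ hx1 hm).trans hxX
  have hν1 : 1 ≤ ν := by omega
  have hν1R : (1 : ℝ) ≤ ν := by exact_mod_cast hν1
  have hνx : (ν : ℝ) ≤ Real.exp Cn * x := by
    have := hnu ν L hν1 hL0.le hνL
    rw [hx, ← Real.exp_add]
    have h2 := Real.add_one_le_exp (Cn + θ * L)
    linarith
  have hLx : L ≤ x / θ := by
    rw [le_div_iff₀ hθ]
    have := Real.add_one_le_exp (θ * L)
    linarith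
  have hlx : (l : ℝ) ≤ C1 * x := by
    calc (l : ℝ) ≤ 10 ^ 9 * L := hlL
      _ ≤ 10 ^ 9 * (x / θ) := by gcongr
      _ = C1 * x := by rw [hC1]; ring
  have hl0 : (0 : ℝ) < l := by exact_mod_cast (by omega : 0 < l)
  set lam := Nat.clog 2 l with hlam
  have hlam1 : 1 ≤ lam := Nat.clog_pos (by norm_num) (by omega)
  have hlaml : lam ≤ l := Nat.clog_le_of_le_pow (Nat.lt_pow_self (by norm_num)).le
  have hκx : (κ : ℝ) ≤ C2 * x ^ 2 := by
    have h1 : κ ≤ 193 * ν * l := by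
      rw [hκ, hk]
      have h2 : n * lam ≤ ν * l := Nat.mul_le_mul (by omega) hlaml
      have h3 : n ≤ ν * l := by
        calc n = n * 1 := by ring
          _ ≤ ν * l := Nat.mul_le_mul (by omega) (by omega)
      have h4 : 1 ≤ ν * l := Nat.mul_pos hν1 (by omega)
      have h5 : 193 * ν * l = 193 * (ν * l) := by ring
      omega
    calc (κ : ℝ) ≤ 193 * ν * l := by exact_mod_cast h1
      _ ≤ 193 * (Real.exp Cn * x) * (C1 * x) := by gcongr
      _ = C2 * x ^ 2 := by rw [hC2]; ring
  have hΘ1 : (Θ : ℝ) ≤ ν * (768 * 10 ^ 18 * Cl * L ^ (1 + θ)) := by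
    have h1 : k + 1 ≤ ν * lam := by
      rw [hk, hν, add_mul]; omega
    have h2 : (lam : ℝ) ≤ Cl * (10 ^ 9 * L ^ θ) := by
      refine (hclog l).trans ?_
      gcongr
      calc (l : ℝ) ^ θ ≤ (10 ^ 9 * L) ^ θ := by gcongr
        _ = (10 ^ 9) ^ θ * L ^ θ := Real.mul_rpow (by norm_num) hL0.le
        _ ≤ 10 ^ 9 * L ^ θ := by
            gcongr
            calc ((10 : ℝ) ^ 9) ^ θ ≤ ((10 : ℝ) ^ 9) ^ (1 : ℝ) :=
                  Real.rpow_le_rpow_of_exponent_le (by norm_num) hθ1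
              _ = _ := Real.rpow_one _
    have h3 : (Θ : ℝ) = 384 * ((k + 1 : ℕ) : ℝ) * (W * l) := by rw [hΘ]; push_cast; ring
    have h4 : ((k + 1 : ℕ) : ℝ) ≤ ν * lam := by exact_mod_cast h1
    rw [h3]
    calc 384 * ((k + 1 : ℕ) : ℝ) * (W * l) ≤ 384 * (ν * (Cl * (10 ^ 9 * L ^ θ))) * (2 * 10 ^ 9 * L) := by
          gcongr
          exact h4.trans (by gcongr)
      _ = ν * (768 * 10 ^ 18 * Cl * (L * L ^ θ)) := by ring
      _ = _ := by rw [Real.rpow_add hL0, Real.rpow_one]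
  have hΘpos : 1 ≤ Θ := by
    rw [hΘ]; exact Nat.mul_pos (Nat.mul_pos (by omega) hW) (by omega)
  have hΘn : (Θ : ℝ) ^ n ≤ K1 * (ν : ℝ) ^ (2 * ν) * x ^ 4 := by
    have h1 : (1 : ℝ) ≤ Θ := by exact_mod_cast hΘpos
    calc (Θ : ℝ) ^ n ≤ (Θ : ℝ) ^ ν := pow_le_pow_right₀ h1 (by omega)
      _ ≤ (ν * (768 * 10 ^ 18 * Cl * L ^ (1 + θ))) ^ ν := by gcongr
      _ = (ν : ℝ) ^ ν * (768 * 10 ^ 18 * Cl * L ^ (1 + θ)) ^ ν := mul_pow _ _ _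
      _ ≤ (ν : ℝ) ^ ν * (K1 * (ν : ℝ) ^ ν * x ^ 4) := by
          gcongr; exact hP1 ν L hν1 hL hνL
      _ = _ := by rw [two_mul, pow_add]; ring
  have hν2 : (ν : ℝ) ^ (2 * ν) ≤ Real.exp Cm * X ^ 3 := by
    have h1 := hnu2 ν L hν1 hL0.le hνL
    have h2 : (ν : ℝ) ^ (2 * ν) = Real.exp (2 * (ν * Real.log ν)) := by
      rw [← Real.exp_log (show (0 : ℝ) < (ν : ℝ) ^ (2 * ν) by positivity), Real.log_pow]
      congr 1; push_cast; ring
    rw [h2, hX, ← Real.exp_nat_mul, ← Real.exp_add]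
    apply Real.exp_le_exp.2
    push_cast
    nlinarith
  have hΘX : (Θ : ℝ) ^ n ≤ K2 * X ^ 4 := by
    calc (Θ : ℝ) ^ n ≤ K1 * (ν : ℝ) ^ (2 * ν) * x ^ 4 := hΘn
      _ ≤ K1 * (Real.exp Cm * X ^ 3) * X := by gcongr; exact hxm 4 (by norm_num)
      _ = _ := by rw [hK2]; ring
  set β := (B : ℝ) ^ θ with hβ
  have hB1 : (1 : ℝ) ≤ B := by exact_mod_cast hB
  have hβ1 : 1 ≤ β := Real.one_le_rpow hB1 hθ.le
  have hβB : ∀ m : ℕ, m ≤ 40 → β ^ m ≤ B := by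
    intro m hm
    rw [hβ, ← Real.rpow_natCast, ← Real.rpow_mul (by linarith)]
    calc (B : ℝ) ^ (θ * m) ≤ (B : ℝ) ^ (1 : ℝ) := by
          apply Real.rpow_le_rpow_of_exponent_le hB1
          have : (m : ℝ) ≤ 40 := by exact_mod_cast hm
          nlinarith
      _ = B := Real.rpow_one _
  have hdx : (d : ℝ) ≤ C3 * β * x ^ 6 := by
    have h1 : (d : ℝ) ≤ 2 * (Cl * ((16 * B * p * l ^ 2 * κ * Θ ^ n : ℕ) : ℝ) ^ θ) := by
      calc (d : ℝ) ≤ 2 * (Nat.clog 2 (16 * B * p * l ^ 2 * κ * Θ ^ n) : ℕ) := by exact_mod_cast hd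
        _ ≤ _ := by gcongr; exact hclog _
    have h2 : ((16 * B * p * l ^ 2 * κ * Θ ^ n : ℕ) : ℝ) ≤ D0 * B * X ^ 6 := by
      push_cast
      calc (16 * B * p * l ^ 2 * κ * Θ ^ n : ℝ) ≤ 16 * B * X * (C1 * x) ^ 2 * (C2 * x ^ 2) * (K2 * X ^ 4) := by
            gcongr
        _ = D0 * B * X ^ 5 * x ^ 4 := by rw [hD0]; ring
        _ ≤ D0 * B * X ^ 5 * X := by gcongr; exact hxm 4 (by norm_num)
        _ = _ := by ring
    calc (d : ℝ) ≤ 2 * (Cl * (D0 * B * X ^ 6) ^ θ) := h1.trans (by gcongr)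
      _ = C3 * β * x ^ 6 := by
          rw [Real.mul_rpow (by positivity) (by positivity), Real.mul_rpow (by positivity) (by positivity),
            hXx, hC3, hβ]; ring
  have hyx : ((y + 1 : ℕ) : ℝ) ≤ C4 * β * x ^ 6 := by
    have h1 : (y : ℝ) ≤ Cl * ((192 * p * d ^ 2 * l ^ 3 * κ ^ 2 * Θ ^ n : ℕ) : ℝ) ^ θ := by
      calc (y : ℝ) ≤ (Nat.clog 2 (192 * p * d ^ 2 * l ^ 3 * κ ^ 2 * Θ ^ n) : ℕ) := by exact_mod_cast hy
        _ ≤ _ := hclog _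
    have h2 : ((192 * p * d ^ 2 * l ^ 3 * κ ^ 2 * Θ ^ n : ℕ) : ℝ) ≤ Y0 * B * X ^ 6 := by
      push_cast
      calc (192 * p * d ^ 2 * l ^ 3 * κ ^ 2 * Θ ^ n : ℝ)
          ≤ 192 * X * (C3 * β * x ^ 6) ^ 2 * (C1 * x) ^ 3 * (C2 * x ^ 2) ^ 2 * (K2 * X ^ 4) := by
            gcongr
        _ = Y0 * β ^ 2 * X ^ 5 * x ^ 19 := by rw [hY0]; ring
        _ ≤ Y0 * B * X ^ 5 * X := by
            gcongr
            · exact hβB 2 (by norm_num)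
            · exact hxm 19 (by norm_num)
        _ = _ := by ring
    have h3 : (y : ℝ) ≤ Cl * Y0 ^ θ * β * x ^ 6 := by
      calc (y : ℝ) ≤ Cl * (Y0 * B * X ^ 6) ^ θ := h1.trans (by gcongr)
        _ = _ := by
          rw [Real.mul_rpow (by positivity) (by positivity), Real.mul_rpow (by positivity) (by positivity),
            hXx, hβ]; ring
    have h4 : 1 ≤ β * x ^ 6 := one_le_mul_of_one_le_of_one_le hβ1 (one_le_pow₀ hx1)
    push_cast
    have : C4 * β * x ^ 6 = Cl * Y0 ^ θ * β * x ^ 6 + β * x ^ 6 := by rw [hC4]; ring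
    linarith
  have hfin : Real.exp (δ * L) = x ^ 40 := by
    rw [hx, ← Real.exp_nat_mul]; congr 1; rw [hθd]; push_cast; ring
  have hfinB : (B : ℝ) ^ δ = β ^ 40 := by
    rw [hβ, ← Real.rpow_natCast, ← Real.rpow_mul (by linarith)]; congr 1; rw [hθd]; push_cast; ring
  rw [hfin, hfinB]
  calc ((1168 * p * l ^ 3 * d ^ 2 * κ ^ 2 * (y + 1) * Θ ^ n : ℕ) : ℝ)
      = 1168 * p * l ^ 3 * d ^ 2 * κ ^ 2 * ((y + 1 : ℕ) : ℝ) * (Θ : ℝ) ^ n := by push_cast; ring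
    _ ≤ 1168 * p * (C1 * x) ^ 3 * (C3 * β * x ^ 6) ^ 2 * (C2 * x ^ 2) ^ 2 * (C4 * β * x ^ 6) *
        (K1 * (ν : ℝ) ^ (2 * ν) * x ^ 4) := by gcongr
    _ = (1168 * C1 ^ 3 * C3 ^ 2 * C2 ^ 2 * C4 * K1) * p * (ν : ℝ) ^ (2 * ν) * x ^ 29 * β ^ 3 := by ring
    _ ≤ _ := by
        gcongr
        · exact le_max_right _ _
        · norm_num
        · norm_num

end

section

theorem factorial_le_prod_primes (s : Finset ℕ) (hs : ∀ p ∈ s, 2 ≤ p) :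
    (s.card + 1).factorial ≤ ∏ p ∈ s, p := by
  induction s using Finset.induction_on_max with
  | empty => simp
  | insert a s hmax ih =>
    have ha : a ∉ s := fun h => lt_irrefl _ (hmax a h)
    rw [Finset.card_insert_of_notMem ha, Finset.prod_insert ha, Nat.factorial_succ]
    refine Nat.mul_le_mul ?_ (ih fun p hp => hs p (Finset.mem_insert_of_mem hp))
    have h1 : s ⊆ Finset.Ico 2 a := fun p hp =>
      Finset.mem_Ico.2 ⟨hs p (Finset.mem_insert_of_mem hp), hmax p hp⟩
    have h2 := Finset.card_le_card h1
    rw [Nat.card_Ico] at h2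
    have h3 := hs a (Finset.mem_insert_self _ _)
    omega

theorem prod_val_eq {t : Finset ℕ} {x : ℕ} (hx : x ≠ 0) (h : x.primeFactors ⊆ t) :
    ∏ r ∈ t, r ^ x.factorization r = x := by
  conv_rhs => rw [← Nat.prod_factorization_pow_eq_self hx]
  rw [Finsupp.prod_of_support_subset _ h _ (by simp)]

theorem local_bound (δ : ℝ) (hδ : 0 < δ) (hδ1 : δ ≤ 1) : ∃ K : ℝ, 1 ≤ K ∧
    ∀ (s : Finset ℕ) (p x y V B : ℕ), (∀ r ∈ s, r.Prime) → p ∈ s → 2 ≤ s.card → x ≠ 0 → y ≠ 0 →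
      Nat.Coprime x y → x ≠ y → x.primeFactors ⊆ s.erase p → y.primeFactors ⊆ s.erase p →
      x ^ 2 ≡ y ^ 2 [MOD p ^ V] → 1 ≤ B → (∀ r, 2 * x.factorization r ≤ B) →
      (∀ r, 2 * y.factorization r ≤ B) →
      (V : ℝ) ≤ K * p * (s.card : ℝ) ^ (2 * s.card) * ((∏ r ∈ s, r : ℕ) : ℝ) ^ δ * (B : ℝ) ^ δ := by
  obtain ⟨K, hK, hasym⟩ := asym δ hδ hδ1
  refine ⟨K, hK, ?_⟩
  intro s p x y V B hs hp hcard hx hy hxy hne hxs hys hmod hB hBx hBy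
  classical
  have hpp := hs p hp
  set R := ∏ r ∈ s, r with hR
  have hRpos : 0 < R := Finset.prod_pos fun r hr => (hs r hr).pos
  have hfac := factorial_le_prod_primes s fun r hr => (hs r hr).two_le
  rw [← hR] at hfac
  have hR6 : 6 ≤ R := le_trans (by
    calc 6 = (2 + 1).factorial := rfl
      _ ≤ _ := Nat.factorial_le (by omega)) hfac
  have hR0 : (0 : ℝ) < R := by exact_mod_cast hRpos
  set L := Real.log R with hL
  have hexpL : Real.exp L = R := Real.exp_log hR0
  have hL1 : 1 ≤ L := by
    rw [hL, Real.le_log_iff_exp_le hR0]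
    have : (6 : ℝ) ≤ R := by exact_mod_cast hR6
    linarith [Real.exp_one_lt_d9]
  set ν := s.card with hν
  have hνpos : (0 : ℝ) < ν := by exact_mod_cast (by omega : 0 < ν)
  have hνL : ν * Real.log ν - ν ≤ L := by
    have h1 := Real.pow_div_factorial_le_exp (ν : ℝ) hνpos.le ν
    have h2 : ((ν.factorial : ℕ) : ℝ) ≤ R := by
      exact_mod_cast (Nat.factorial_le (by omega)).trans hfac
    have h3 : (ν : ℝ) ^ ν ≤ Real.exp ν * R := by
      rw [div_le_iff₀ (by positivity)] at h1
      exact h1.trans (by gcongr)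
    have h4 := Real.log_le_log (by positivity) h3
    rw [Real.log_pow, Real.log_mul (by positivity) (by positivity), Real.log_exp] at h4
    linarith
  have hpR : p ≤ R := Nat.le_of_dvd hRpos (Finset.dvd_prod_of_mem _ hp)
  obtain ⟨l, hl, hlp, hlog⟩ := exists_ell p hpp
  have hlpL : Real.log p ≤ L := Real.log_le_log (by exact_mod_cast hpp.pos) (by exact_mod_cast hpR)
  set W := Nat.clog p R with hW
  have hW1 : 1 ≤ W := Nat.clog_pos hpp.one_lt (by omega)
  have hWl : (W * l : ℝ) ≤ 2 * 10 ^ 9 * L := by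
    have h1 := Nat.pow_pred_clog_lt_self (b := p) hpp.one_lt (x := R) (by omega)
    rw [← hW, Nat.pred_eq_sub_one] at h1
    have h2 : (p : ℝ) ^ (W - 1) ≤ R := by exact_mod_cast h1.le
    have hp0 : (0 : ℝ) < p := by exact_mod_cast hpp.pos
    have h3 := Real.log_le_log (by positivity) h2
    rw [Real.log_pow, Nat.cast_sub hW1] at h3
    push_cast at h3
    have h4 : (W : ℝ) * Real.log p ≤ 2 * L := by linarith
    calc (W * l : ℝ) ≤ W * (10 ^ 9 * Real.log p) := by gcongr
      _ = 10 ^ 9 * (W * Real.log p) := by ring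
      _ ≤ 10 ^ 9 * (2 * L) := by gcongr
      _ = _ := by ring
  set n := ν - 1 with hn
  have hcn : (s.erase p).card = n := by rw [Finset.card_erase_of_mem hp]
  let e := Finset.equivFinOfCardEq hcn
  let q : Fin n → ℕ := fun i => (e.symm i : ℕ)
  have hqmem : ∀ i, q i ∈ s.erase p := fun i => (e.symm i).2
  have hprod : ∀ f : ℕ → ℕ, ∏ i, f (q i) = ∏ r ∈ s.erase p, f r := by
    intro f
    rw [Equiv.prod_comp e.symm (fun r : s.erase p => f r), Finset.prod_coe_sort]
  let b : Fin n → ℤ := fun i => 2 * ((x.factorization (q i) : ℤ) - y.factorization (q i))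
  have hzero : ∀ r : ℕ, r.Prime → x.factorization r = 0 ∨ y.factorization r = 0 := by
    intro r hr
    by_contra h
    push Not at h
    have h1 := Nat.dvd_of_factorization_pos h.1
    have h2 := Nat.dvd_of_factorization_pos h.2
    exact hr.one_lt.ne' (Nat.dvd_one.1 (hxy ▸ Nat.dvd_gcd h1 h2))
  have hqp : ∀ i, (q i).Prime := fun i => hs _ (Finset.mem_of_mem_erase (hqmem i))
  have hb1 : ∏ i, q i ^ (b i).toNat = x ^ 2 := by
    have : ∀ i, q i ^ (b i).toNat = (q i ^ x.factorization (q i)) ^ 2 := by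
      intro i
      rw [← pow_mul]
      congr 1
      rcases hzero (q i) (hqp i) with h | h <;> simp only [b, h] <;> omega
    rw [Finset.prod_congr rfl (fun i _ => this i), Finset.prod_pow,
      hprod (fun r => r ^ x.factorization r), prod_val_eq hx hxs]
  have hb2 : ∏ i, q i ^ (-b i).toNat = y ^ 2 := by
    have : ∀ i, q i ^ (-b i).toNat = (q i ^ y.factorization (q i)) ^ 2 := by
      intro i
      rw [← pow_mul]
      congr 1
      rcases hzero (q i) (hqp i) with h | h <;> simp only [b, h] <;> omega
    rw [Finset.prod_congr rfl (fun i _ => this i), Finset.prod_pow,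
      hprod (fun r => r ^ y.factorization r), prod_val_eq hy hys]
  have hex : ∃ i0, b i0 ≠ 0 := by
    by_contra h
    push Not at h
    have : x ^ 2 = y ^ 2 := by
      rw [← hb1, ← hb2]; simp [h]
    exact hne (Nat.pow_left_injective (n := 2) (by norm_num) this)
  obtain ⟨i0, hi0⟩ := hex
  obtain ⟨d, y', hd, hy', hV⟩ := baker_nat (V := V) (W := W) (B := B) (q := q) (b := b) (i0 := i0) hpp hqp
    (fun i => Finset.ne_of_mem_erase (hqmem i))
    (fun i j hij => e.symm.injective (Subtype.ext hij)) hi0 (by rw [hb1, hb2]; exact hmod) hl hlp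
    (by
      refine le_trans ?_ (Nat.le_pow_clog hpp.one_lt R)
      rw [hprod (fun r => r), hR]
      exact Finset.prod_le_prod_of_subset_of_one_le' (Finset.erase_subset _ _)
        (fun r hr _ => (hs r hr).pos)) hW1
    (by
      intro i
      have h1 := hBx (q i)
      have h2 := hBy (q i)
      rw [abs_le]
      simp only [b]
      omega) _ _ _ rfl rfl rfl
  have hfin := hasym ν n p l W B d y' _ _ _ L (by omega) (by omega) hl.two_le hB hW1 hL1 hνL
    (by rw [hexpL]; exact_mod_cast hpR) hpp.pos (by
      refine hlog.trans ?_; gcongr) hWl rfl rfl rfl hd hy'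
  have h1 : (V : ℝ) ≤ _ := (Nat.cast_le.2 hV).trans hfin
  refine h1.trans (le_of_eq ?_)
  rw [hL, mul_comm δ, Real.exp_mul, Real.exp_log hR0]

end

section

theorem triple_local (a b c : ℕ) (ha : 0 < a) (hb : 0 < b) (hc : 0 < c) (hab : Nat.Coprime a b)
    (hac : Nat.Coprime a c) (hbc : Nat.Coprime b c) (h : a + b = c) (hN : a * b * c ≠ 2)
    (p : ℕ) (hp : p ∈ (a * b * c).primeFactors) :
    2 ≤ (a * b * c).primeFactors.card ∧ ∃ x y : ℕ, x ≠ 0 ∧ y ≠ 0 ∧ Nat.Coprime x y ∧ x ≠ y ∧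
      x.primeFactors ⊆ (a * b * c).primeFactors.erase p ∧
      y.primeFactors ⊆ (a * b * c).primeFactors.erase p ∧
      x ^ 2 ≡ y ^ 2 [MOD p ^ (a * b * c).factorization p] ∧ x ∣ a * b * c ∧ y ∣ a * b * c := by
  set N := a * b * c with hNd
  have hN0 : N ≠ 0 := by positivity
  have hpp : p.Prime := Nat.prime_of_mem_primeFactors hp
  have hpN : p ∣ N := Nat.dvd_of_mem_primeFactors hp
  set V := N.factorization p with hV
  have hVd : p ^ V ∣ N := Nat.ordProj_dvd N p
  suffices hmain : ∃ x y : ℕ, x ≠ 0 ∧ y ≠ 0 ∧ Nat.Coprime x y ∧ x ≠ y ∧ ¬ p ∣ x ∧ ¬ p ∣ y ∧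
      x ^ 2 ≡ y ^ 2 [MOD p ^ V] ∧ x ∣ N ∧ y ∣ N by
    obtain ⟨x, y, hx, hy, hco, hne, hpx, hpy, hmod, hxN, hyN⟩ := hmain
    have hsub : ∀ z, ¬ p ∣ z → z ∣ N → z.primeFactors ⊆ N.primeFactors.erase p := by
      intro z hz hzN r hr
      rw [Finset.mem_erase]
      refine ⟨?_, Nat.primeFactors_mono hzN hN0 hr⟩
      rintro rfl
      exact hz (Nat.dvd_of_mem_primeFactors hr)
    have hxs := hsub x hpx hxN
    have hys := hsub y hpy hyN
    refine ⟨?_, x, y, hx, hy, hco, hne, hxs, hys, hmod, hxN, hyN⟩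
    have hnon : (N.primeFactors.erase p).Nonempty := by
      by_contra hcon
      rw [Finset.not_nonempty_iff_eq_empty] at hcon
      rw [hcon, Finset.subset_empty, Nat.primeFactors_eq_empty] at hxs hys
      omega
    have h1 := Finset.card_pos.2 hnon
    rw [Finset.card_erase_of_mem hp] at h1
    omega
  have hcop : ∀ u w : ℕ, p ∣ u → Nat.Coprime u w → ¬ p ∣ w := by
    intro u w hu huw hw
    exact hpp.one_lt.ne' (Nat.dvd_one.1 (huw ▸ Nat.dvd_gcd hu hw))
  have hVdiv : ∀ u w : ℕ, N = u * w → ¬ p ∣ w → p ^ V ∣ u := by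
    intro u w hN hw
    rw [hN] at hVd
    exact (Nat.Coprime.pow_left V ((Nat.Prime.coprime_iff_not_dvd hpp).2 hw)).dvd_of_dvd_mul_right hVd
  rcases (Nat.Prime.dvd_mul hpp).1 hpN with h1 | h1
  · rcases (Nat.Prime.dvd_mul hpp).1 h1 with h2 | h2
    · have hpb := hcop a b h2 hab
      have hpc := hcop a c h2 hac
      refine ⟨b, c, hb.ne', hc.ne', hbc, by omega, hpb, hpc, ?_, ⟨a * c, by rw [hNd]; ring⟩,
        ⟨a * b, by rw [hNd]; ring⟩⟩
      have hd := hVdiv a (b * c) (by rw [hNd]; ring) (by rw [hpp.dvd_mul]; tauto)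
      apply Nat.ModEq.pow
      rw [← h]
      have := (Nat.modEq_zero_iff_dvd.2 hd).add_right b
      simpa using this.symm
    · have hpa := hcop b a h2 hab.symm
      have hpc := hcop b c h2 hbc
      refine ⟨a, c, ha.ne', hc.ne', hac, by omega, hpa, hpc, ?_, ⟨b * c, by rw [hNd]; ring⟩,
        ⟨a * b, by rw [hNd]; ring⟩⟩
      have hd := hVdiv b (a * c) (by rw [hNd]; ring) (by rw [hpp.dvd_mul]; tauto)
      apply Nat.ModEq.pow
      rw [← h]
      have := (Nat.modEq_zero_iff_dvd.2 hd).add_left a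
      simpa using this.symm
  · have hpa := hcop c a h1 hac.symm
    have hpb := hcop c b h1 hbc.symm
    refine ⟨a, b, ha.ne', hb.ne', hab, ?_, hpa, hpb, ?_, ⟨b * c, by rw [hNd]; ring⟩,
        ⟨a * c, by rw [hNd]; ring⟩⟩
    · rintro rfl
      rw [Nat.coprime_self] at hab
      subst hab
      apply hN; rw [hNd, ← h]
    · have hd := hVdiv c (a * b) (by rw [hNd]; ring) (by rw [hpp.dvd_mul]; tauto)
      rw [← h] at hd
      rw [Nat.modEq_iff_dvd]
      have h3 : ((p ^ V : ℕ) : ℤ) ∣ ((a + b : ℕ) : ℤ) := by exact_mod_cast hd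
      push_cast at h3 ⊢
      have : (b : ℤ) ^ 2 - (a : ℤ) ^ 2 = (a + b) * (b - a) := by ring
      rw [this]
      exact h3.mul_right _

end

section

theorem nu_pow_le (s : Finset ℕ) (hs : ∀ p ∈ s, 2 ≤ p) (h1 : 1 ≤ s.card) :
    (s.card : ℝ) ^ (2 * s.card) ≤ ((∏ r ∈ s, r : ℕ) : ℝ) ^ 6 := by
  have hfac := factorial_le_prod_primes s hs
  set R := ∏ r ∈ s, r
  set ν := s.card
  have h2 : 2 ^ ν ≤ R := by
    refine le_trans ?_ hfac
    have : (1 + 1) ^ ν ≤ (1 + ν).factorial := by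
      have := Nat.factorial_mul_pow_le_factorial (m := 1) (n := ν)
      simpa using this
    rw [add_comm] ; simpa [add_comm] using this
  have hν : (0 : ℝ) ≤ ν := by positivity
  have h3 := Real.pow_div_factorial_le_exp (ν : ℝ) hν ν
  rw [div_le_iff₀ (by positivity)] at h3
  have h4 : ((ν.factorial : ℕ) : ℝ) ≤ R := by
    exact_mod_cast (Nat.factorial_le (by omega)).trans hfac
  have h5 : Real.exp ν ≤ (R : ℝ) ^ 2 := by
    calc Real.exp ν = Real.exp 1 ^ ν := by rw [← Real.exp_nat_mul, mul_one]
      _ ≤ 4 ^ ν := by gcongr; linarith [Real.exp_one_lt_d9]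
      _ = ((2 : ℝ) ^ ν) ^ 2 := by rw [← pow_mul, mul_comm, pow_mul]; norm_num
      _ ≤ (R : ℝ) ^ 2 := by gcongr; exact_mod_cast h2
  calc (ν : ℝ) ^ (2 * ν) = ((ν : ℝ) ^ ν) ^ 2 := by rw [← pow_mul, mul_comm]
    _ ≤ ((R : ℝ) ^ 2 * R) ^ 2 := by gcongr; exact h3.trans (by gcongr)
    _ = _ := by ring

theorem val_bound (ε : ℝ) (hε : 0 < ε) (hε1 : ε ≤ 1) : ∃ K : ℝ, 1 ≤ K ∧ ∀ a b c : ℕ, 0 < a → 0 < b → 0 < c →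
      Nat.Coprime a b → Nat.Coprime a c → Nat.Coprime b c → a + b = c → a * b * c ≠ 2 →
      ∀ p ∈ (a * b * c).primeFactors, ((a * b * c).factorization p : ℝ) ≤
        K * p * ((a * b * c).primeFactors.card : ℝ) ^ (2 * (a * b * c).primeFactors.card) *
          ((∏ p ∈ (a * b * c).primeFactors, p : ℕ) : ℝ) ^ ε := by
  obtain ⟨K0, hK0, hloc0⟩ := local_bound (1 / 2) (by norm_num) (by norm_num)
  set δ := ε / 20 with hδ
  have hδ0 : 0 < δ := by positivity
  obtain ⟨K, hK, hloc⟩ := local_bound δ hδ0 (by rw [hδ]; linarith)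
  set D : ℝ := (4 * K0 ^ 2) ^ δ with hD
  have hD1 : 1 ≤ D := Real.one_le_rpow (by nlinarith) hδ0.le
  refine ⟨K * D, one_le_mul_of_one_le_of_one_le hK hD1, ?_⟩
  intro a b c ha hb hc hab hac hbc h hN p hp
  have htl := triple_local a b c ha hb hc hab hac hbc h hN
  set N := a * b * c with hNd
  have hN0 : N ≠ 0 := by positivity
  set s := N.primeFactors with hs
  have hsp : ∀ r ∈ s, r.Prime := fun r hr => Nat.prime_of_mem_primeFactors hr
  have hcard : 2 ≤ s.card := (htl p hp).1
  have hνR := nu_pow_le s (fun r hr => (hsp r hr).two_le) (by omega)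
  set R := ∏ r ∈ s, r with hR
  have hRpos : 0 < R := Finset.prod_pos fun r hr => (hsp r hr).pos
  have hR1 : (1 : ℝ) ≤ R := by exact_mod_cast hRpos
  obtain ⟨r0, hr0, hmax⟩ := Finset.exists_max_image s (fun r => N.factorization r) ⟨p, hp⟩
  set M := N.factorization r0 with hM
  have hM1 : 1 ≤ M := (hsp r0 hr0).factorization_pos_of_dvd hN0 (Nat.dvd_of_mem_primeFactors hr0)
  have hMall : ∀ z, z ∣ N → ∀ r, 2 * z.factorization r ≤ 2 * M := by
    intro z hz r
    have h1 : z.factorization r ≤ N.factorization r :=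
      (Nat.factorization_le_iff_dvd (ne_zero_of_dvd_ne_zero hN0 hz) hN0).2 hz r
    by_cases hr : r ∈ s
    · have := hmax r hr; omega
    · have h2 : N.factorization r = 0 := by
        rw [← Finsupp.notMem_support_iff, Nat.support_factorization]; exact hr
      omega
  have hB : ((2 * M : ℕ) : ℝ) ≤ 4 * K0 ^ 2 * (R : ℝ) ^ (18 : ℝ) := by
    obtain ⟨-, x, y, hx, hy, hco, hne, hxs, hys, hmod, hxN, hyN⟩ := htl r0 hr0
    have h1 := hloc0 s r0 x y M (2 * M) hsp hr0 hcard hx hy hco hne hxs hys hmod (by omega)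
      (hMall x hxN) (hMall y hyN)
    have hr0R : (r0 : ℝ) ≤ R := by exact_mod_cast Nat.le_of_dvd hRpos (Finset.dvd_prod_of_mem _ hr0)
    rw [← hR, ← Real.sqrt_eq_rpow, ← Real.sqrt_eq_rpow] at h1
    set z := √((2 * M : ℕ) : ℝ) with hz
    have hz2 : z ^ 2 = ((2 * M : ℕ) : ℝ) := Real.sq_sqrt (by positivity)
    have hz0 : 0 < z := Real.sqrt_pos.2 (by exact_mod_cast (by omega : 0 < 2 * M))
    have hsR : √(R : ℝ) ≤ R := by
      rw [Real.sqrt_le_left (by linarith)]; nlinarith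
    have h2 : (M : ℝ) ≤ K0 * R ^ 8 * z := by
      calc (M : ℝ) ≤ _ := h1
        _ ≤ K0 * R * R ^ 6 * R * z := by gcongr
        _ = _ := by ring
    have h3 : z * z ≤ 2 * K0 * R ^ 8 * z := by
      rw [← pow_two, hz2]; push_cast; linarith
    have h4 := le_of_mul_le_mul_right h3 hz0
    rw [← hz2]
    calc z ^ 2 ≤ (2 * K0 * R ^ 8) ^ 2 := by gcongr
      _ = 4 * K0 ^ 2 * (R : ℝ) ^ 16 := by ring
      _ ≤ 4 * K0 ^ 2 * (R : ℝ) ^ 18 := by gcongr; norm_num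
      _ = _ := by norm_cast
  obtain ⟨-, x, y, hx, hy, hco, hne, hxs, hys, hmod, hxN, hyN⟩ := htl p hp
  have h1 := hloc s p x y _ (2 * M) hsp hp hcard hx hy hco hne hxs hys hmod (by omega)
      (hMall x hxN) (hMall y hyN)
  rw [← hR] at h1
  have h2 : ((2 * M : ℕ) : ℝ) ^ δ ≤ D * (R : ℝ) ^ (18 * δ) := by
    calc ((2 * M : ℕ) : ℝ) ^ δ ≤ (4 * K0 ^ 2 * (R : ℝ) ^ (18 : ℝ)) ^ δ := by gcongr
      _ = _ := by
        rw [Real.mul_rpow (by positivity) (by positivity), ← Real.rpow_mul (by linarith)]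
  refine h1.trans ?_
  calc _ ≤ K * p * (s.card : ℝ) ^ (2 * s.card) * (R : ℝ) ^ δ * (D * (R : ℝ) ^ (18 * δ)) := by gcongr
    _ = K * D * p * (s.card : ℝ) ^ (2 * s.card) * ((R : ℝ) ^ δ * (R : ℝ) ^ (18 * δ)) := by ring
    _ ≤ _ := by
      rw [← Real.rpow_add (by linarith)]
      gcongr
      rw [hδ]; linarith

theorem abc_divisor_bound_fixed_omega (ε : ℝ) (hε : 0 < ε) :
    ∃ C : ℝ, 1 < C ∧ ∀ a b c : ℕ, 0 < a → 0 < b → 0 < c →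
      Nat.Coprime a b → Nat.Coprime a c → Nat.Coprime b c → a + b = c →
      ((a * b * c).divisors.card : ℝ) /
          (Real.log ((a * b * c).divisors.card)) ^ ((a * b * c).primeFactors.card) <
        C ^ ((a * b * c).primeFactors.card) *
          ((a * b * c).primeFactors.card : ℝ) ^ (2 * (a * b * c).primeFactors.card ^ 2) *
          ((∏ p ∈ (a * b * c).primeFactors, p : ℕ) : ℝ) ^
            ((1 : ℝ) + ε * (a * b * c).primeFactors.card) := by
  obtain ⟨K, hK, hval⟩ := val_bound (min ε 1) (lt_min hε one_pos) (min_le_right _ _)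
  refine ⟨5 * K, by linarith, ?_⟩
  intro a b c ha hb hc hab hac hbc h
  by_cases hN : a * b * c = 2
  · rw [hN]
    have h1 : (Nat.divisors 2).card = 2 := by decide
    have h2 : Nat.primeFactors 2 = {2} := Nat.Prime.primeFactors Nat.prime_two
    rw [h1, h2]
    simp only [Finset.card_singleton, Finset.prod_singleton, pow_one, Nat.cast_one, one_pow, mul_one]
    have hl := Real.log_two_gt_d9
    have h3 : (2 : ℝ) ^ (1 : ℝ) ≤ 2 ^ (1 + ε) :=
      Real.rpow_le_rpow_of_exponent_le (by norm_num) (by linarith)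
    rw [Real.rpow_one] at h3
    push_cast
    rw [div_lt_iff₀ (by linarith)]
    have h4 : (5 : ℝ) * 1 * 2 * 0.69 ≤ 5 * K * 2 ^ (1 + ε) * Real.log 2 := by gcongr; linarith
    linarith
  have hv := hval a b c ha hb hc hab hac hbc h hN
  set N := a * b * c with hNd
  have hN0 : N ≠ 0 := by positivity
  have hN1 : 1 < N := by
    rw [hNd, ← h]
    calc 1 < 1 * 1 * (1 + 1) := by norm_num
      _ ≤ _ := by gcongr <;> omega
  set s := N.primeFactors with hs
  have hsp : ∀ r ∈ s, r.Prime := fun r hr => Nat.prime_of_mem_primeFactors hr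
  set ν := s.card with hν
  have hν1 : 1 ≤ ν := Finset.card_pos.2 (Nat.nonempty_primeFactors.2 hN1)
  set R := ∏ r ∈ s, r with hR
  have hR1 : (1 : ℝ) ≤ R := by exact_mod_cast (Finset.prod_pos fun r hr => (hsp r hr).pos : 0 < R)
  set t := min ε 1 with ht
  have hd2 : 2 ≤ N.divisors.card := by
    have : ({1, N} : Finset ℕ) ⊆ N.divisors := by
      intro z hz
      rw [Finset.mem_insert, Finset.mem_singleton] at hz
      rcases hz with rfl | rfl <;> simp [hN0]
    have h2 := Finset.card_le_card this
    rwa [Finset.card_pair (by omega)] at h2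
  have hlog : (1 / 2 : ℝ) ≤ Real.log N.divisors.card := by
    have : Real.log 2 ≤ Real.log N.divisors.card := Real.log_le_log (by norm_num) (by exact_mod_cast hd2)
    linarith [Real.log_two_gt_d9]
  have hdle : (N.divisors.card : ℝ) ≤ (2 * K) ^ ν * R * (ν : ℝ) ^ (2 * ν ^ 2) * (R : ℝ) ^ (ε * ν) := by
    rw [Nat.card_divisors hN0]
    push_cast
    calc ∏ r ∈ s, ((N.factorization r : ℝ) + 1)
        ≤ ∏ r ∈ s, ((2 * K * (ν : ℝ) ^ (2 * ν) * (R : ℝ) ^ t) * r) := by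
          apply Finset.prod_le_prod
          · intro r _; positivity
          · intro r hr
            have h1 := hv r hr
            have h2 : 1 ≤ N.factorization r :=
              (hsp r hr).factorization_pos_of_dvd hN0 (Nat.dvd_of_mem_primeFactors hr)
            have h3 : (1 : ℝ) ≤ N.factorization r := by exact_mod_cast h2
            have h4 : (2 * K * (ν : ℝ) ^ (2 * ν) * (R : ℝ) ^ t) * r =
              2 * (K * r * (ν : ℝ) ^ (2 * ν) * (R : ℝ) ^ t) := by ring
            rw [h4]; linarith
      _ = (2 * K * (ν : ℝ) ^ (2 * ν) * (R : ℝ) ^ t) ^ ν * R := by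
          rw [Finset.prod_mul_distrib, Finset.prod_const, hR]; push_cast; rfl
      _ = (2 * K) ^ ν * R * (ν : ℝ) ^ (2 * ν ^ 2) * ((R : ℝ) ^ t) ^ ν := by
          rw [mul_pow, mul_pow, ← pow_mul (ν : ℝ)]
          rw [show 2 * ν * ν = 2 * ν ^ 2 by ring]; ring
      _ ≤ _ := by
          rw [← Real.rpow_natCast ((R : ℝ) ^ t), ← Real.rpow_mul (by linarith)]
          gcongr
          exact min_le_left _ _
  have hdiv : (N.divisors.card : ℝ) / (Real.log N.divisors.card) ^ ν ≤ N.divisors.card * 2 ^ ν := by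
    rw [div_le_iff₀ (by positivity)]
    have : 1 ≤ (2 * Real.log N.divisors.card) ^ ν := one_le_pow₀ (by linarith)
    rw [mul_assoc, ← mul_pow]
    exact le_mul_of_one_le_right (by positivity) this
  have hν0 : (0 : ℝ) < ν := by exact_mod_cast hν1
  calc _ ≤ (N.divisors.card : ℝ) * 2 ^ ν := hdiv
    _ ≤ ((2 * K) ^ ν * R * (ν : ℝ) ^ (2 * ν ^ 2) * (R : ℝ) ^ (ε * ν)) * 2 ^ ν := by gcongr
    _ = (4 * K) ^ ν * ((ν : ℝ) ^ (2 * ν ^ 2) * (R ^ (1 : ℝ) * (R : ℝ) ^ (ε * ν))) := by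
        rw [show (4 : ℝ) * K = (2 * K) * 2 by ring, mul_pow (2 * K) 2, Real.rpow_one]; ring
    _ < (5 * K) ^ ν * ((ν : ℝ) ^ (2 * ν ^ 2) * (R ^ (1 : ℝ) * (R : ℝ) ^ (ε * ν))) := by
        have hR0 : (0 : ℝ) < R := by linarith
        apply mul_lt_mul_of_pos_right _ (by positivity)
        exact pow_lt_pow_left₀ (by linarith) (by positivity) (by omega)
    _ = _ := by
        rw [← Real.rpow_add (by linarith)]; ring

end
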